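/- arXiv:2107.11735 — 2 statements merged into one kernel-verified Lean document; each statement's English description precedes it below -/
import Mathlib

section
/- The function Q is strictly convex on (0, z_B), and its derivative satisfies lim_{z→z_B−} Q′(z) = 0 and lim_{z→0+} Q′(z) = −∞. -/
open MeasureTheory

lemma aux_fub (μ : Measure ℝ) [SFinite μ] (D : Set (ℝ × ℝ)) (hD : MeasurableSet D)
    (k φ K : ℝ → ℝ) (hk : AEStronglyMeasurable k μ) (hk0 : ∀ᵐ η ∂μ, 0 ≤ k η)
    (hφ : AEStronglyMeasurable φ μ)
    (hK : ∀ᵐ s ∂μ, Integrable (fun η => D.indicator (fun _ => (1:ℝ)) (s, η) * k η) μ ∧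
      ∫ η, D.indicator (fun _ => (1:ℝ)) (s, η) * k η ∂μ = K s)
    (hφK : Integrable (fun s => φ s * K s) μ) :
    Integrable (fun η => k η * ∫ s, D.indicator (fun _ => (1:ℝ)) (s, η) * φ s ∂μ) μ ∧
    ∫ η, k η * ∫ s, D.indicator (fun _ => (1:ℝ)) (s, η) * φ s ∂μ ∂μ = ∫ s, φ s * K s ∂μ := by
  set F : ℝ × ℝ → ℝ := fun x => φ x.1 * (D.indicator (fun _ => (1:ℝ)) x * k x.2) with hF
  have hFm : AEStronglyMeasurable F (μ.prod μ) := by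
    refine (hφ.comp_fst).mul (AEStronglyMeasurable.mul ?_ hk.comp_snd)
    exact ((measurable_const.indicator hD).stronglyMeasurable).aestronglyMeasurable
  have hFi : Integrable F (μ.prod μ) := by
    rw [integrable_prod_iff hFm]
    constructor
    · filter_upwards [hK] with s hs
      exact hs.1.const_mul (φ s)
    · refine hφK.norm.congr ?_
      filter_upwards [hK] with s hs
      have h1 : ∀ᵐ η ∂μ, ‖F (s, η)‖ = |φ s| * (D.indicator (fun _ => (1:ℝ)) (s, η) * k η) := by
        filter_upwards [hk0] with η hη
        have : 0 ≤ D.indicator (fun _ => (1:ℝ)) (s, η) := Set.indicator_nonneg (by simp) _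
        simp only [hF, Real.norm_eq_abs, abs_mul]
        rw [abs_of_nonneg this, abs_of_nonneg hη]
      rw [integral_congr_ae h1, integral_const_mul, hs.2, Real.norm_eq_abs, abs_mul]
      congr 1
      apply abs_of_nonneg
      rw [← hs.2]
      apply integral_nonneg_of_ae
      filter_upwards [hk0] with η hη
      exact mul_nonneg (Set.indicator_nonneg (by simp) _) hη
  have key : ∀ η, ∫ s, F (s, η) ∂μ = k η * ∫ s, D.indicator (fun _ => (1:ℝ)) (s, η) * φ s ∂μ := by
    intro η
    rw [← integral_const_mul]
    congr 1; ext s; simp only [hF]; ring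
  constructor
  · refine (hFi.integral_prod_right).congr (Filter.Eventually.of_forall fun η => key η)
  · have := integral_integral_swap (f := fun s η => F (s, η)) hFi
    simp only [key] at this
    rw [← this]
    apply integral_congr_ae
    filter_upwards [hK] with s hs
    simp only [hF, integral_const_mul, hs.2]

lemma aux_zero (p z : ℝ) (hp : 0 < p) (hz : 0 < z) (g φ : ℝ → ℝ)
    (hg : ∀ a b, 0 < a → a ≤ b → ∫ s in a..b, φ s = g b - g a)
    (hi : IntegrableOn (fun s => s ^ p * φ s) (Set.Ioo 0 z)) :
    IntegrableOn (fun η => η ^ (p - 1) * g η) (Set.Ioo 0 z) ∧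
    p * ∫ η in Set.Ioo 0 z, η ^ (p - 1) * g η = z ^ p * g z - ∫ s in Set.Ioo 0 z, s ^ p * φ s := by
  have hpow : ∀ s : ℝ, 0 < s → IntegrableOn (fun η : ℝ => η ^ (p-1)) (Set.Ioo 0 s) := by
    intro s hs
    have := (intervalIntegral.intervalIntegrable_rpow' (a := 0) (b := s) (r := p - 1) (by linarith))
    rw [intervalIntegrable_iff_integrableOn_Ioo_of_le hs.le] at this
    exact this
  have hpowI : ∀ s : ℝ, 0 < s → ∫ η in Set.Ioo 0 s, η ^ (p-1) = s ^ p / p := by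
    intro s hs
    rw [← integral_Ioc_eq_integral_Ioo, ← intervalIntegral.integral_of_le hs.le,
      integral_rpow (Or.inl (by linarith))]
    simp [Real.zero_rpow hp.ne']
  have hφm : AEStronglyMeasurable φ (volume.restrict (Set.Ioo 0 z)) := by
    have h1 : AEStronglyMeasurable (fun s : ℝ => s ^ (-p)) (volume.restrict (Set.Ioo 0 z)) :=
      (measurable_id.pow_const _).aestronglyMeasurable
    refine (h1.mul hi.1).congr ?_
    filter_upwards [ae_restrict_mem measurableSet_Ioo] with s hs
    simp only [Pi.mul_apply]
    rw [← mul_assoc, ← Real.rpow_add hs.1]; simp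
  set D : Set (ℝ × ℝ) := {x | x.2 < x.1} with hDdef
  have hD : MeasurableSet D := measurableSet_lt measurable_snd measurable_fst
  have h1 : ∀ s ∈ Set.Ioo 0 z, ∀ f : ℝ → ℝ, (∫ η in Set.Ioo 0 z, D.indicator (fun _ => (1:ℝ)) (s, η) * f η) = ∫ η in Set.Ioo 0 s, f η := by
    intro s hs f
    have : (fun η => D.indicator (fun _ => (1:ℝ)) (s, η) * f η) = (Set.Iio s).indicator f := by
      ext η; simp only [Set.indicator, hDdef, Set.mem_ofPred_eq, Set.mem_Iio]; split_ifs <;> simp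
    rw [this, setIntegral_indicator measurableSet_Iio]
    congr 2; ext x; simp; intro _ h; linarith [hs.2]
  have h2 : ∀ η ∈ Set.Ioo 0 z, (∫ s in Set.Ioo 0 z, D.indicator (fun _ => (1:ℝ)) (s, η) * φ s) = g z - g η := by
    intro η hη
    have : (fun s => D.indicator (fun _ => (1:ℝ)) (s, η) * φ s) = (Set.Ioi η).indicator φ := by
      ext s; simp only [Set.indicator, hDdef, Set.mem_ofPred_eq, Set.mem_Ioi]; split_ifs <;> simp
    rw [this, setIntegral_indicator measurableSet_Ioi, ← hg η z hη.1 hη.2.le,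
      intervalIntegral.integral_of_le hη.2.le, integral_Ioc_eq_integral_Ioo]
    congr 2; ext x; simp
    constructor
    · rintro ⟨⟨_, h⟩, h'⟩; exact ⟨h', h⟩
    · rintro ⟨h, h'⟩; exact ⟨⟨hη.1.trans h, h'⟩, h⟩
  have key := aux_fub (volume.restrict (Set.Ioo 0 z)) D hD (fun η => η ^ (p-1)) φ (fun s => s ^ p / p)
    (measurable_id.pow_const _).aestronglyMeasurable
    (by filter_upwards [ae_restrict_mem measurableSet_Ioo] with s hs
        exact Real.rpow_nonneg hs.1.le _) hφm
    (by filter_upwards [ae_restrict_mem measurableSet_Ioo] with s hs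
        refine ⟨?_, by rw [h1 s hs, hpowI s hs.1]⟩
        have : (fun η => D.indicator (fun _ => (1:ℝ)) (s, η) * η ^ (p-1)) = (Set.Iio s).indicator (fun η => η ^ (p-1)) := by
          ext η; simp only [Set.indicator, hDdef, Set.mem_ofPred_eq, Set.mem_Iio]; split_ifs <;> simp
        rw [this]
        exact (hpow z hz).indicator measurableSet_Iio)
    (by refine (hi.div_const p).congr (Filter.Eventually.of_forall fun s => ?_)
        simp only; ring)
  obtain ⟨k1, k2⟩ := key
  have e : (fun η => η ^ (p-1) * ∫ s in Set.Ioo 0 z, D.indicator (fun _ => (1:ℝ)) (s, η) * φ s) =ᵐ[volume.restrict (Set.Ioo 0 z)]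
      fun η => η ^ (p-1) * (g z - g η) := by
    filter_upwards [ae_restrict_mem measurableSet_Ioo] with η hη
    rw [h2 η hη]
  have k1' := k1.congr e
  rw [integral_congr_ae e] at k2
  have k3 : IntegrableOn (fun η => η ^ (p-1) * g z) (Set.Ioo 0 z) := (hpow z hz).mul_const _
  have k4 : IntegrableOn (fun η => η ^ (p - 1) * g η) (Set.Ioo 0 z) := by
    refine (k3.sub k1').congr (Filter.Eventually.of_forall fun s => ?_)
    simp only [Pi.sub_apply]; ring
  refine ⟨k4, ?_⟩
  have k5 : ∫ η in Set.Ioo 0 z, η ^ (p-1) * (g z - g η) = z ^ p / p * g z - ∫ η in Set.Ioo 0 z, η ^ (p-1) * g η := by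
    rw [← hpowI z hz, ← integral_mul_const, ← integral_sub k3 k4]
    congr 1; ext; ring
  have k6 : ∫ s in Set.Ioo 0 z, φ s * (s ^ p / p) = (∫ s in Set.Ioo 0 z, s ^ p * φ s) / p := by
    rw [← integral_div]; congr 1; ext; ring
  rw [k5, k6] at k2
  field_simp at k2
  linarith

lemma aux_inf (q z : ℝ) (hq : 0 < q) (hz : 0 < z) (g φ : ℝ → ℝ)
    (hg : ∀ a b, 0 < a → a ≤ b → ∫ s in a..b, φ s = g b - g a)
    (hi : IntegrableOn (fun s => s ^ (-q) * φ s) (Set.Ioi z)) :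
    IntegrableOn (fun η => η ^ (-q - 1) * g η) (Set.Ioi z) ∧
    q * ∫ η in Set.Ioi z, η ^ (-q - 1) * g η = z ^ (-q) * g z + ∫ s in Set.Ioi z, s ^ (-q) * φ s := by
  have hpow : ∀ s : ℝ, 0 < s → IntegrableOn (fun η : ℝ => η ^ (-q-1)) (Set.Ioi s) := by
    intro s hs
    exact integrableOn_Ioi_rpow_of_lt (by linarith) hs
  have hpowI : ∀ s : ℝ, 0 < s → ∫ η in Set.Ioi s, η ^ (-q-1) = s ^ (-q) / q := by
    intro s hs
    rw [integral_Ioi_rpow_of_lt (by linarith) hs]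
    rw [sub_add_cancel, neg_div_neg_eq]
  have hφm : AEStronglyMeasurable φ (volume.restrict (Set.Ioi z)) := by
    have h1 : AEStronglyMeasurable (fun s : ℝ => s ^ (q)) (volume.restrict (Set.Ioi z)) :=
      (measurable_id.pow_const _).aestronglyMeasurable
    refine (h1.mul hi.1).congr ?_
    filter_upwards [ae_restrict_mem measurableSet_Ioi] with s hs
    simp only [Pi.mul_apply]
    rw [← mul_assoc, ← Real.rpow_add (hz.trans hs)]; simp
  set D : Set (ℝ × ℝ) := {x | x.1 < x.2} with hDdef
  have hD : MeasurableSet D := measurableSet_lt measurable_fst measurable_snd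
  have h1 : ∀ s ∈ Set.Ioi z, ∀ f : ℝ → ℝ, (∫ η in Set.Ioi z, D.indicator (fun _ => (1:ℝ)) (s, η) * f η) = ∫ η in Set.Ioi s, f η := by
    intro s hs f
    have : (fun η => D.indicator (fun _ => (1:ℝ)) (s, η) * f η) = (Set.Ioi s).indicator f := by
      ext η; simp only [Set.indicator, hDdef, Set.mem_ofPred_eq, Set.mem_Ioi]; split_ifs <;> simp
    rw [this, setIntegral_indicator measurableSet_Ioi]
    congr 2; ext x; simp; intro h; exact lt_trans hs h
  have h2 : ∀ η ∈ Set.Ioi z, (∫ s in Set.Ioi z, D.indicator (fun _ => (1:ℝ)) (s, η) * φ s) = g η - g z := by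
    intro η hη
    have : (fun s => D.indicator (fun _ => (1:ℝ)) (s, η) * φ s) = (Set.Iio η).indicator φ := by
      ext s; simp only [Set.indicator, hDdef, Set.mem_ofPred_eq, Set.mem_Iio]; split_ifs <;> simp
    rw [this, setIntegral_indicator measurableSet_Iio, ← hg z η hz (le_of_lt hη),
      intervalIntegral.integral_of_le (le_of_lt hη), integral_Ioc_eq_integral_Ioo]
    rfl
  have key := aux_fub (volume.restrict (Set.Ioi z)) D hD (fun η => η ^ (-q-1)) φ (fun s => s ^ (-q) / q)
    (measurable_id.pow_const _).aestronglyMeasurable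
    (by filter_upwards [ae_restrict_mem measurableSet_Ioi] with s hs
        exact Real.rpow_nonneg (hz.trans hs).le _) hφm
    (by filter_upwards [ae_restrict_mem measurableSet_Ioi] with s hs
        refine ⟨?_, by rw [h1 s hs, hpowI s (hz.trans hs)]⟩
        have : (fun η => D.indicator (fun _ => (1:ℝ)) (s, η) * η ^ (-q-1)) = (Set.Ioi s).indicator (fun η => η ^ (-q-1)) := by
          ext η; simp only [Set.indicator, hDdef, Set.mem_ofPred_eq, Set.mem_Ioi]; split_ifs <;> simp
        rw [this]
        exact (hpow z hz).indicator measurableSet_Ioi)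
    (by refine (hi.div_const q).congr (Filter.Eventually.of_forall fun s => ?_)
        simp only; ring)
  obtain ⟨k1, k2⟩ := key
  have e : (fun η => η ^ (-q-1) * ∫ s in Set.Ioi z, D.indicator (fun _ => (1:ℝ)) (s, η) * φ s) =ᵐ[volume.restrict (Set.Ioi z)]
      fun η => η ^ (-q-1) * (g η - g z) := by
    filter_upwards [ae_restrict_mem measurableSet_Ioi] with η hη
    rw [h2 η hη]
  have k1' := k1.congr e
  rw [integral_congr_ae e] at k2
  have k3 : IntegrableOn (fun η => η ^ (-q-1) * g z) (Set.Ioi z) := (hpow z hz).mul_const _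
  have k4 : IntegrableOn (fun η => η ^ (-q - 1) * g η) (Set.Ioi z) := by
    refine (k3.add k1').congr (Filter.Eventually.of_forall fun s => ?_)
    simp only [Pi.add_apply]; ring
  refine ⟨k4, ?_⟩
  have k5 : ∫ η in Set.Ioi z, η ^ (-q-1) * (g η - g z) = (∫ η in Set.Ioi z, η ^ (-q-1) * g η) - z ^ (-q) / q * g z := by
    rw [← hpowI z hz, ← integral_mul_const, ← integral_sub k4 k3]
    congr 1; ext; ring
  have k6 : ∫ s in Set.Ioi z, φ s * (s ^ (-q) / q) = (∫ s in Set.Ioi z, s ^ (-q) * φ s) / q := by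
    rw [← integral_div]; congr 1; ext; ring
  rw [k5, k6] at k2
  field_simp at k2
  linarith

lemma aux_M0 (f : ℝ → ℝ) (hf : ContinuousOn f (Set.Ioi 0))
    (hi : ∀ z, 0 < z → IntegrableOn f (Set.Ioo 0 z)) (z : ℝ) (hz : 0 < z) :
    HasDerivAt (fun z => ∫ η in Set.Ioo 0 z, f η) (f z) z := by
  have hii : IntervalIntegrable f volume 0 z := by
    rw [intervalIntegrable_iff_integrableOn_Ioo_of_le hz.le]; exact hi z hz
  have := intervalIntegral.integral_hasDerivAt_right hii
    (hf.stronglyMeasurableAtFilter isOpen_Ioi z hz) (hf.continuousAt (Ioi_mem_nhds hz))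
  refine this.congr_of_eventuallyEq ?_
  filter_upwards [Ioi_mem_nhds hz] with x hx
  rw [intervalIntegral.integral_of_le (le_of_lt hx), integral_Ioc_eq_integral_Ioo]

lemma aux_Ioi_sub (f : ℝ → ℝ) (a b : ℝ) (hab : a ≤ b) (hi : IntegrableOn f (Set.Ioi a)) :
    ∫ η in Set.Ioi a, f η = (∫ η in a..b, f η) + ∫ η in Set.Ioi b, f η := by
  rw [intervalIntegral.integral_of_le hab, ← setIntegral_union (Set.Ioc_disjoint_Ioi le_rfl) measurableSet_Ioi
    (hi.mono_set Set.Ioc_subset_Ioi_self) (hi.mono_set (Set.Ioi_subset_Ioi hab)), Set.Ioc_union_Ioi_eq_Ioi hab]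

lemma aux_Ioo_add (f : ℝ → ℝ) (a b : ℝ) (ha : 0 < a) (hab : a ≤ b) (hi : IntegrableOn f (Set.Ioo 0 b)) :
    ∫ η in Set.Ioo 0 b, f η = (∫ η in Set.Ioo 0 a, f η) + ∫ η in a..b, f η := by
  have hi' := hi
  rw [← integrableOn_Ioc_iff_integrableOn_Ioo] at hi'
  rw [← integral_Ioc_eq_integral_Ioo, ← integral_Ioc_eq_integral_Ioo, intervalIntegral.integral_of_le hab,
    ← setIntegral_union (Set.Ioc_disjoint_Ioc_of_le le_rfl) measurableSet_Ioc
    (hi'.mono_set (Set.Ioc_subset_Ioc_right hab)) (hi'.mono_set (Set.Ioc_subset_Ioc_left ha.le)), 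
    Set.Ioc_union_Ioc_eq_Ioc ha.le hab]

lemma aux_Minf (f : ℝ → ℝ) (hf : ContinuousOn f (Set.Ioi 0))
    (hi : ∀ z, 0 < z → IntegrableOn f (Set.Ioi z)) (z : ℝ) (hz : 0 < z) :
    HasDerivAt (fun z => ∫ η in Set.Ioi z, f η) (- f z) z := by
  have hz2 : 0 < z / 2 := by linarith
  have hzz : z / 2 < z := by linarith
  have hii : IntervalIntegrable f volume (z/2) z := by
    rw [intervalIntegrable_iff_integrableOn_Ioo_of_le hzz.le]
    exact (hi _ hz2).mono_set Set.Ioo_subset_Ioi_self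
  have := (intervalIntegral.integral_hasDerivAt_right hii
    (hf.stronglyMeasurableAtFilter isOpen_Ioi z hz) (hf.continuousAt (Ioi_mem_nhds hz))).const_sub (∫ η in Set.Ioi (z/2), f η)
  refine this.congr_of_eventuallyEq ?_
  filter_upwards [Ioi_mem_nhds hzz] with x hx
  rw [aux_Ioi_sub f _ x (le_of_lt hx) (hi _ hz2)]; ring

lemma aux_L (m₁ m₂ c₁ c₂ v z : ℝ) (M₁ M₂ : ℝ → ℝ) (hz : 0 < z)
    (h₁ : HasDerivAt M₁ (-(z ^ (-m₁ - 1) * v)) z) (h₂ : HasDerivAt M₂ (z ^ (-m₂ - 1) * v) z) :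
    HasDerivAt (fun z => z ^ m₂ * (M₂ z - c₂) + z ^ m₁ * (M₁ z - c₁))
      (m₂ * z ^ (m₂ - 1) * (M₂ z - c₂) + m₁ * z ^ (m₁ - 1) * (M₁ z - c₁)) z := by
  have e1 := Real.hasDerivAt_rpow_const (x := z) (p := m₁) (Or.inl hz.ne')
  have e2 := Real.hasDerivAt_rpow_const (x := z) (p := m₂) (Or.inl hz.ne')
  have := (e2.mul (h₂.sub_const c₂)).add (e1.mul (h₁.sub_const c₁))
  refine this.congr_deriv ?_
  have a1 : z ^ m₁ * z ^ (-m₁ - 1) = z⁻¹ := by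
    rw [← Real.rpow_add hz, ← Real.rpow_neg_one]; congr 1; ring
  have a2 : z ^ m₂ * z ^ (-m₂ - 1) = z⁻¹ := by
    rw [← Real.rpow_add hz, ← Real.rpow_neg_one]; congr 1; ring
  linear_combination v * a2 - v * a1

lemma aux_L2 (m₁ m₂ c₁ c₂ v z : ℝ) (M₁ M₂ : ℝ → ℝ) (hz : 0 < z)
    (h₁ : HasDerivAt M₁ (-(z ^ (-m₁ - 1) * v)) z) (h₂ : HasDerivAt M₂ (z ^ (-m₂ - 1) * v) z) :
    HasDerivAt (fun z => m₂ * z ^ (m₂ - 1) * (M₂ z - c₂) + m₁ * z ^ (m₁ - 1) * (M₁ z - c₁))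
      (m₂ * (m₂ - 1) * z ^ (m₂ - 2) * (M₂ z - c₂) + m₁ * (m₁ - 1) * z ^ (m₁ - 2) * (M₁ z - c₁)
        + (m₂ - m₁) * v * z ^ (-2 : ℝ)) z := by
  have e1 := (Real.hasDerivAt_rpow_const (x := z) (p := m₁ - 1) (Or.inl hz.ne')).const_mul m₁
  have e2 := (Real.hasDerivAt_rpow_const (x := z) (p := m₂ - 1) (Or.inl hz.ne')).const_mul m₂
  have := (e2.mul (h₂.sub_const c₂)).add (e1.mul (h₁.sub_const c₁))
  refine this.congr_deriv ?_
  have a1 : z ^ (m₁ - 1) * z ^ (-m₁ - 1) = z ^ (-2 : ℝ) := by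
    rw [← Real.rpow_add hz]; congr 1; ring
  have a2 : z ^ (m₂ - 1) * z ^ (-m₂ - 1) = z ^ (-2 : ℝ) := by
    rw [← Real.rpow_add hz]; congr 1; ring
  rw [show m₁ - 1 - 1 = m₁ - 2 by ring, show m₂ - 1 - 1 = m₂ - 2 by ring]
  linear_combination m₂ * v * a2 - m₁ * v * a1

lemma aux_S (n₁ n₂ zR zB w : ℝ) (hn₂ : n₂ < 0) (hn₁ : 1 < n₁) (G : ℝ → ℝ)
    (hG : StrictMonoOn G (Set.Ioi 0)) (hzR : 0 < zR) (hw : zR ≤ w) (hwB : w < zB)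
    (hS : 0 < (n₁ - 1) * zR ^ (n₁ - 2) * (∫ η in zR..zB, η ^ (-n₁) * G η) +
      (1 - n₂) * zR ^ (n₂ - 2) * (∫ η in zR..zB, η ^ (-n₂) * G η)) :
    0 < (n₁ - 1) * w ^ (n₁ - 2) * (∫ η in w..zB, η ^ (-n₁) * G η) +
      (1 - n₂) * w ^ (n₂ - 2) * (∫ η in w..zB, η ^ (-n₂) * G η) := by
  have hw0 : 0 < w := by linarith
  have hpc : ∀ n a b : ℝ, 0 < a → a ≤ b → ContinuousOn (fun η : ℝ => η ^ n) (Set.uIcc a b) := by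
    intro n a b ha hab
    rw [Set.uIcc_of_le hab]
    exact fun x hx => (Real.continuousAt_rpow_const x n (Or.inl (by linarith [hx.1]))).continuousWithinAt
  have hint : ∀ n a b : ℝ, 0 < a → a ≤ b → IntervalIntegrable (fun η => η ^ n * G η) volume a b := by
    intro n a b ha hab
    refine IntervalIntegrable.continuousOn_mul (MonotoneOn.intervalIntegrable ?_) (hpc n a b ha hab)
    rw [Set.uIcc_of_le hab]
    exact hG.monotoneOn.mono fun x hx => ha.trans_le hx.1
  have hint1 : ∀ n a b : ℝ, 0 < a → a ≤ b → IntervalIntegrable (fun η : ℝ => η ^ n) volume a b := by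
    intro n a b ha hab
    exact (hpc n a b ha hab).intervalIntegrable
  have hpw : ∀ n a b : ℝ, n ≠ 1 → 0 < a → a ≤ b → (1 - n) * ∫ η in a..b, η ^ (-n) = b ^ (1 - n) - a ^ (1 - n) := by
    intro n a b hn ha hab
    rw [integral_rpow (Or.inr ⟨by contrapose! hn; linarith, by rw [Set.uIcc_of_le hab]; simp [ha]⟩)]
    have : 1 - n ≠ 0 := by contrapose! hn; linarith
    rw [show -n + 1 = 1 - n by ring]; field_simp
  rcases le_or_gt 0 (G w) with h0 | h0
  · have hp : ∀ n : ℝ, 0 < ∫ η in w..zB, η ^ n * G η := by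
      intro n
      refine intervalIntegral.intervalIntegral_pos_of_pos_on (hint n w zB hw0 hwB.le) ?_ hwB
      intro x hx
      have hx0 : 0 < x := hw0.trans hx.1
      exact mul_pos (Real.rpow_pos_of_pos hx0 _) (h0.trans_lt (hG hw0 hx0 hx.1))
    have a1 := mul_pos (mul_pos (sub_pos.2 hn₁) (Real.rpow_pos_of_pos hw0 (n₁ - 2))) (hp (-n₁))
    have a2 := mul_pos (mul_pos (show 0 < 1 - n₂ by linarith) (Real.rpow_pos_of_pos hw0 (n₂ - 2))) (hp (-n₂))
    linarith
  · have hlow : G w * (∫ η in w..zB, η ^ (-n₁)) ≤ ∫ η in w..zB, η ^ (-n₁) * G η := by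
      rw [← intervalIntegral.integral_const_mul]
      refine intervalIntegral.integral_mono_on hwB.le ((hint1 _ _ _ hw0 hwB.le).const_mul _) (hint _ _ _ hw0 hwB.le) ?_
      intro x hx
      have hx0 : 0 < x := hw0.trans_le hx.1
      rw [mul_comm]
      exact mul_le_mul_of_nonneg_left (hG.monotoneOn hw0 hx0 hx.1) (Real.rpow_nonneg hx0.le _)
    have hup : ∀ n : ℝ, (∫ η in zR..w, η ^ (-n) * G η) ≤ G w * ∫ η in zR..w, η ^ (-n) := by
      intro n
      rw [← intervalIntegral.integral_const_mul]
      refine intervalIntegral.integral_mono_on hw (hint _ _ _ hzR hw) ((hint1 _ _ _ hzR hw).const_mul _) ?_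
      intro x hx
      have hx0 : 0 < x := hzR.trans_le hx.1
      rw [mul_comm (G w)]
      exact mul_le_mul_of_nonneg_left (hG.monotoneOn hx0 hw0 hx.2) (Real.rpow_nonneg hx0.le _)
    have hsp : ∀ n : ℝ, (∫ η in zR..zB, η ^ n * G η) = (∫ η in zR..w, η ^ n * G η) + ∫ η in w..zB, η ^ n * G η := by
      intro n
      rw [intervalIntegral.integral_add_adjacent_intervals (hint _ _ _ hzR hw) (hint _ _ _ hw0 hwB.le)]
    rw [hsp, hsp] at hS
    have u1 := hup n₁
    have u2 := hup n₂
    have p1 := hpw n₁ w zB (by linarith) hw0 hwB.le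
    have p2 := hpw n₁ zR w (by linarith) hzR hw
    have p3 := hpw n₂ zR w (by linarith) hzR hw
    have pB : 0 < zB ^ (1 - n₁) := Real.rpow_pos_of_pos (by linarith) _
    have hWZ : zR ^ (n₁ - n₂) ≤ w ^ (n₁ - n₂) := Real.rpow_le_rpow hzR.le hw (by linarith)
    have hZ : 0 < zR ^ (n₁ - n₂) := Real.rpow_pos_of_pos hzR _
    have r1 : w ^ (n₁ - n₂) * w ^ (1 - n₁) = w ^ (1 - n₂) := by rw [← Real.rpow_add hw0]; congr 1; ring
    have r2 : zR ^ (n₁ - n₂) * zR ^ (1 - n₁) = zR ^ (1 - n₂) := by rw [← Real.rpow_add hzR]; congr 1; ring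
    have f1 : w ^ (n₁ - 2) = w ^ (n₂ - 2) * w ^ (n₁ - n₂) := by rw [← Real.rpow_add hw0]; congr 1; ring
    have f2 : zR ^ (n₁ - 2) = zR ^ (n₂ - 2) * zR ^ (n₁ - n₂) := by rw [← Real.rpow_add hzR]; congr 1; ring
    have q1 : 0 < w ^ (n₂ - 2) := Real.rpow_pos_of_pos hw0 _
    have q2 : 0 < zR ^ (n₂ - 2) := Real.rpow_pos_of_pos hzR _
    rw [f1]
    rw [f2] at hS
    generalize (∫ η in w..zB, η ^ (-n₁) * G η) = P1 at *
    generalize (∫ η in w..zB, η ^ (-n₂) * G η) = P2 at *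
    generalize (∫ η in zR..w, η ^ (-n₁) * G η) = Q1 at *
    generalize (∫ η in zR..w, η ^ (-n₂) * G η) = Q2 at *
    generalize (∫ η in w..zB, η ^ (-n₁)) = k1 at *
    generalize (∫ η in zR..w, η ^ (-n₁)) = k2 at *
    generalize (∫ η in zR..w, η ^ (-n₂)) = k3 at *
    generalize w ^ (n₁ - n₂) = W at *
    generalize zR ^ (n₁ - n₂) = Z at *
    generalize w ^ (n₂ - 2) = x1 at *
    generalize zR ^ (n₂ - 2) = x2 at *
    generalize w ^ (1 - n₁) = y1 at *
    generalize zR ^ (1 - n₁) = y2 at *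
    generalize w ^ (1 - n₂) = y3 at *
    generalize zR ^ (1 - n₂) = y4 at *
    generalize zB ^ (1 - n₁) = y5 at *
    generalize G w = g at *
    have hT : 0 < (n₁ - 1) * Z * (Q1 + P1) + (1 - n₂) * (Q2 + P2) := by
      have : 0 < x2 * ((n₁ - 1) * Z * (Q1 + P1) + (1 - n₂) * (Q2 + P2)) := by linarith
      exact pos_of_mul_pos_right this q2.le
    have hT2 : 0 < (n₁ - 1) * W * P1 + (1 - n₂) * P2 := by
      have s1 : g * y1 ≤ (n₁ - 1) * P1 := by
        have := mul_le_mul_of_nonneg_left hlow (sub_pos.2 hn₁).le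
        have e : (n₁ - 1) * (g * k1) = g * (y1 - y5) := by linear_combination (-g) * p1
        nlinarith
      have s2 : (n₁ - 1) * Q1 ≤ g * (y2 - y1) := by
        have := mul_le_mul_of_nonneg_left u1 (sub_pos.2 hn₁).le
        have e : (n₁ - 1) * (g * k2) = g * (y2 - y1) := by linear_combination (-g) * p2
        linarith
      have s3 : (1 - n₂) * Q2 ≤ g * (y3 - y4) := by
        have := mul_le_mul_of_nonneg_left u2 (show 0 ≤ 1 - n₂ by linarith)
        have e : (1 - n₂) * (g * k3) = g * (y3 - y4) := by linear_combination g * p3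
        linarith
      have t1 := mul_le_mul_of_nonneg_left s1 (sub_nonneg.2 hWZ)
      have t2 := mul_le_mul_of_nonneg_left s2 hZ.le
      have e : (W - Z) * (g * y1) - Z * (g * (y2 - y1)) - g * (y3 - y4) = 0 := by
        linear_combination g * r1 - g * r2
      nlinarith
    have := mul_pos q1 hT2
    linarith

lemma aux_core (C n₁ n₂ : ℝ) (hC : 0 < C) (hn₂ : n₂ < 0) (hn₁ : 1 < n₁) (I U h G Q : ℝ → ℝ)
    (hIp : ∀ y, 0 < y → 0 < I y) (hIa : StrictAntiOn I (Set.Ioi 0)) (hIc : ContinuousOn I (Set.Ioi 0))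
    (hI0 : Filter.Tendsto I (nhdsWithin 0 (Set.Ioi 0)) Filter.atTop)
    (hUc : ContinuousOn U (Set.Ioi 0)) (hhc : ContinuousOn h (Set.Ioi 0))
    (hUi : ∀ a b, 0 < a → a ≤ b → ∫ s in a..b, -I s = U b - U a)
    (hhi : ∀ a b, 0 < a → a ≤ b → ∫ s in a..b, (G s + I s) = h b - h a)
    (hG : StrictMonoOn G (Set.Ioi 0))
    (iI2 : ∀ z, 0 < z → IntegrableOn (fun η => η ^ (-n₂) * I η) (Set.Ioo 0 z))
    (iG2 : ∀ z, 0 < z → IntegrableOn (fun η => η ^ (-n₂) * G η) (Set.Ioo 0 z))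
    (iI1 : ∀ z, 0 < z → IntegrableOn (fun η => η ^ (-n₁) * I η) (Set.Ioi z))
    (iG1 : ∀ z, 0 < z → IntegrableOn (fun η => η ^ (-n₁) * G η) (Set.Ioi z))
    (zR zB : ℝ) (hzR : 0 < zR) (hRB : zR < zB) (hneg : h zR < 0)
    (hφ1 : (∫ η in Set.Ioi zB, η ^ (-n₁) * G η) - n₁ * ∫ η in Set.Ioi zR, η ^ (-n₁ - 1) * h η = 0)
    (hφ2 : (∫ η in Set.Ioo 0 zB, η ^ (-n₂) * G η) - n₂ * ∫ η in Set.Ioo 0 zR, η ^ (-n₂ - 1) * h η = 0)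
    (J R : ℝ → ℝ)
    (hJ : ∀ z, 0 < z → J z = C * (z ^ n₂ * (∫ η in Set.Ioo 0 z, η ^ (-n₂ - 1) * U η) +
       z ^ n₁ * ∫ η in Set.Ioi z, η ^ (-n₁ - 1) * U η))
    (hR : ∀ z, 0 < z → R z = C * (z ^ n₂ * ((∫ η in Set.Ioo 0 z, η ^ (-n₂ - 1) * h η) - ∫ η in Set.Ioo 0 zR, η ^ (-n₂ - 1) * h η) +
       z ^ n₁ * ((∫ η in Set.Ioi z, η ^ (-n₁ - 1) * h η) - ∫ η in Set.Ioi zR, η ^ (-n₁ - 1) * h η)))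
    (hQ₁ : ∀ z, 0 < z → z ≤ zR → Q z = J z)
    (hQ₂ : ∀ z, zR ≤ z → z ≤ zB → Q z = R z + J z) :
    StrictConvexOn ℝ (Set.Ioo 0 zB) Q ∧
    Filter.Tendsto (deriv Q) (nhdsWithin zB (Set.Iio zB)) (nhds 0) ∧
    Filter.Tendsto (deriv Q) (nhdsWithin 0 (Set.Ioi 0)) Filter.atBot := by
  have hzB : 0 < zB := hzR.trans hRB
  have hpc : ∀ n : ℝ, ContinuousOn (fun η : ℝ => η ^ n) (Set.Ioi 0) := fun n x hx =>
    (Real.continuousAt_rpow_const x n (Or.inl (ne_of_gt hx))).continuousWithinAt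
  -- integration by parts
  have bU2 := fun z hz => aux_zero (-n₂) z (by linarith) hz U (fun s => - I s) hUi
    (by simpa [mul_neg] using (iI2 z hz).neg)
  have bh2 := fun z hz => aux_zero (-n₂) z (by linarith) hz h (fun s => G s + I s) hhi
    (by simp only [mul_add]; exact (iG2 z hz).add (iI2 z hz))
  have bU1 := fun z hz => aux_inf (n₁) z (by linarith) hz U (fun s => - I s) hUi
    (by simpa [mul_neg] using (iI1 z hz).neg)
  have bh1 := fun z hz => aux_inf (n₁) z (by linarith) hz h (fun s => G s + I s) hhi
    (by simp only [mul_add]; exact (iG1 z hz).add (iI1 z hz))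
  set A : ℝ → ℝ := fun z => ∫ η in Set.Ioo 0 z, η ^ (-n₂) * I η with hA
  set B : ℝ → ℝ := fun z => ∫ η in Set.Ioi z, η ^ (-n₁) * I η with hB
  set MU2 : ℝ → ℝ := fun z => ∫ η in Set.Ioo 0 z, η ^ (-n₂ - 1) * U η with hMU2
  set MU1 : ℝ → ℝ := fun z => ∫ η in Set.Ioi z, η ^ (-n₁ - 1) * U η with hMU1
  set Mh2 : ℝ → ℝ := fun z => ∫ η in Set.Ioo 0 z, η ^ (-n₂ - 1) * h η with hMh2
  set Mh1 : ℝ → ℝ := fun z => ∫ η in Set.Ioi z, η ^ (-n₁ - 1) * h η with hMh1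
  set K2 : ℝ → ℝ := fun z => ∫ η in Set.Ioo 0 z, η ^ (-n₂) * G η with hK2
  set K1 : ℝ → ℝ := fun z => ∫ η in Set.Ioi z, η ^ (-n₁) * G η with hK1
  have cU2 : ∀ z, 0 < z → n₂ * MU2 z = - z ^ (-n₂) * U z - A z := by
    intro z hz
    have := (bU2 z hz).2
    simp only [mul_neg, integral_neg] at this
    simp only [hMU2, hA]; linarith
  have ch2 : ∀ z, 0 < z → n₂ * Mh2 z = - z ^ (-n₂) * h z + K2 z + A z := by
    intro z hz
    have := (bh2 z hz).2
    simp only [mul_add] at this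
    rw [integral_add (iG2 z hz) (iI2 z hz)] at this
    simp only [hMh2, hA, hK2]; linarith
  have cU1 : ∀ z, 0 < z → n₁ * MU1 z = z ^ (-n₁) * U z - B z := by
    intro z hz
    have := (bU1 z hz).2
    simp only [mul_neg, integral_neg] at this
    simp only [hMU1, hB]; linarith
  have ch1 : ∀ z, 0 < z → n₁ * Mh1 z = z ^ (-n₁) * h z + K1 z + B z := by
    intro z hz
    have := (bh1 z hz).2
    simp only [mul_add] at this
    rw [integral_add (iG1 z hz) (iI1 z hz)] at this
    simp only [hMh1, hB, hK1]; linarith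
  -- derivatives
  have dA : ∀ z, 0 < z → HasDerivAt A (z ^ (-n₂) * I z) z := fun z hz =>
    aux_M0 _ ((hpc _).mul hIc) iI2 z hz
  have dB : ∀ z, 0 < z → HasDerivAt B (-(z ^ (-n₁) * I z)) z := fun z hz =>
    aux_Minf _ ((hpc _).mul hIc) iI1 z hz
  have dMU2 : ∀ z, 0 < z → HasDerivAt MU2 (z ^ (-n₂ - 1) * U z) z := fun z hz =>
    aux_M0 _ ((hpc _).mul hUc) (fun z hz => (bU2 z hz).1) z hz
  have dMU1 : ∀ z, 0 < z → HasDerivAt MU1 (-(z ^ (-n₁ - 1) * U z)) z := fun z hz =>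
    aux_Minf _ ((hpc _).mul hUc) (fun z hz => (bU1 z hz).1) z hz
  have dMh2 : ∀ z, 0 < z → HasDerivAt Mh2 (z ^ (-n₂ - 1) * h z) z := fun z hz =>
    aux_M0 _ ((hpc _).mul hhc) (fun z hz => (bh2 z hz).1) z hz
  have dMh1 : ∀ z, 0 < z → HasDerivAt Mh1 (-(z ^ (-n₁ - 1) * h z)) z := fun z hz =>
    aux_Minf _ ((hpc _).mul hhc) (fun z hz => (bh1 z hz).1) z hz
  -- J'
  set JP : ℝ → ℝ := fun z => -C * (z ^ (n₂ - 1) * (A z - 0) + z ^ (n₁ - 1) * (B z - 0)) with hJP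
  set JPP : ℝ → ℝ := fun z => -C * ((n₂ - 1) * z ^ (n₂ - 1 - 1) * (A z - 0) + (n₁ - 1) * z ^ (n₁ - 1 - 1) * (B z - 0)) with hJPP
  have dJ : ∀ z, 0 < z → HasDerivAt J (JP z) z := by
    intro z hz
    have := (aux_L n₁ n₂ 0 0 (U z) z MU1 MU2 hz (dMU1 z hz) (dMU2 z hz)).const_mul C
    have h2 : HasDerivAt J (C * (n₂ * z ^ (n₂ - 1) * (MU2 z - 0) + n₁ * z ^ (n₁ - 1) * (MU1 z - 0))) z := by
      refine this.congr_of_eventuallyEq ?_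
      filter_upwards [Ioi_mem_nhds hz] with x hx
      rw [hJ x hx]; simp only [sub_zero, hMU2, hMU1]
    refine h2.congr_deriv ?_
    have e1 : z ^ (n₁ - 1) * z ^ (-n₁) = z⁻¹ := by
      rw [← Real.rpow_add hz, ← Real.rpow_neg_one]; congr 1; ring
    have e2 : z ^ (n₂ - 1) * z ^ (-n₂) = z⁻¹ := by
      rw [← Real.rpow_add hz, ← Real.rpow_neg_one]; congr 1; ring
    simp only [hJP]
    linear_combination C * z ^ (n₂ - 1) * cU2 z hz + C * z ^ (n₁ - 1) * cU1 z hz + C * U z * e1 - C * U z * e2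
  have dJP : ∀ z, 0 < z → HasDerivAt JP (JPP z) z := by
    intro z hz
    refine (aux_L (n₁ - 1) (n₂ - 1) 0 0 (I z) z B A hz ?_ ?_).const_mul (-C)
    · rw [show -(n₁ - 1) - 1 = -n₁ by ring]; exact dB z hz
    · rw [show -(n₂ - 1) - 1 = -n₂ by ring]; exact dA z hz
  -- bounds of A and B
  have bA : ∀ z, 0 < z → I z * z ^ (1 - n₂) < (1 - n₂) * A z := by
    intro z hz
    have i0 : IntervalIntegrable (fun η : ℝ => η ^ (-n₂)) volume 0 z :=
      intervalIntegral.intervalIntegrable_rpow' (by linarith)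
    have i1 : IntervalIntegrable (fun η : ℝ => η ^ (-n₂) * I η) volume 0 z := by
      rw [intervalIntegrable_iff_integrableOn_Ioo_of_le hz.le]; exact iI2 z hz
    have hpos : 0 < ∫ η in (0:ℝ)..z, (η ^ (-n₂) * I η - η ^ (-n₂) * I z) := by
      refine intervalIntegral.intervalIntegral_pos_of_pos_on (i1.sub (i0.mul_const _)) ?_ hz
      intro x hx
      have := mul_pos (Real.rpow_pos_of_pos hx.1 (-n₂)) (sub_pos.2 (hIa hx.1 hz hx.2))
      linarith
    rw [intervalIntegral.integral_sub i1 (i0.mul_const _), intervalIntegral.integral_mul_const,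
      integral_rpow (Or.inl (by linarith)), Real.zero_rpow (by linarith), sub_zero,
      intervalIntegral.integral_of_le hz.le, integral_Ioc_eq_integral_Ioo, show -n₂ + 1 = 1 - n₂ by ring] at hpos
    have h1 : 0 < 1 - n₂ := by linarith
    have := mul_pos h1 hpos
    have e : (1 - n₂) * (z ^ (1 - n₂) / (1 - n₂) * I z) = I z * z ^ (1 - n₂) := by field_simp
    simp only [hA]
    linarith
  have bB : ∀ z, 0 < z → (n₁ - 1) * B z ≤ I z * z ^ (1 - n₁) := by
    intro z hz
    have i0 : IntegrableOn (fun η : ℝ => η ^ (-n₁) * I z) (Set.Ioi z) :=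
      (integrableOn_Ioi_rpow_of_lt (by linarith) hz).mul_const _
    have : B z ≤ ∫ η in Set.Ioi z, η ^ (-n₁) * I z := by
      refine setIntegral_mono_on (iI1 z hz) i0 measurableSet_Ioi ?_
      intro x hx
      have hx0 : 0 < x := hz.trans hx
      exact mul_le_mul_of_nonneg_left (hIa hz hx0 hx).le (Real.rpow_nonneg hx0.le _)
    rw [integral_mul_const, integral_Ioi_rpow_of_lt (by linarith) hz] at this
    have := mul_le_mul_of_nonneg_left this (sub_pos.2 hn₁).le
    have e : (n₁ - 1) * (-z ^ (-n₁ + 1) / (-n₁ + 1) * I z) = I z * z ^ (1 - n₁) := by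
      have : -n₁ + 1 ≠ 0 := by linarith
      rw [show 1 - n₁ = -n₁ + 1 by ring]
      field_simp; ring
    linarith
  have B0 : ∀ z, 0 < z → 0 ≤ B z := by
    intro z hz
    refine setIntegral_nonneg measurableSet_Ioi ?_
    intro x hx
    have hx0 : 0 < x := hz.trans hx
    exact mul_nonneg (Real.rpow_nonneg hx0.le _) (hIp x hx0).le
  have JPPpos : ∀ z, 0 < z → 0 < JPP z := by
    intro z hz
    have t1 := mul_lt_mul_of_pos_left (bA z hz) (Real.rpow_pos_of_pos hz (n₂ - 1 - 1))
    have t2 := mul_le_mul_of_nonneg_left (bB z hz) (Real.rpow_pos_of_pos hz (n₁ - 1 - 1)).le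
    have e1 : z ^ (n₁ - 1 - 1) * z ^ (1 - n₁) = z⁻¹ := by
      rw [← Real.rpow_add hz, ← Real.rpow_neg_one]; congr 1; ring
    have e2 : z ^ (n₂ - 1 - 1) * z ^ (1 - n₂) = z⁻¹ := by
      rw [← Real.rpow_add hz, ← Real.rpow_neg_one]; congr 1; ring
    have e3 : z ^ (n₁ - 1 - 1) * (I z * z ^ (1 - n₁)) = z ^ (n₂ - 1 - 1) * (I z * z ^ (1 - n₂)) := by
      linear_combination I z * e1 - I z * e2
    have : 0 < z ^ (n₂ - 1 - 1) * ((1 - n₂) * A z) - z ^ (n₁ - 1 - 1) * ((n₁ - 1) * B z) := by linarith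
    have := mul_pos hC this
    simp only [hJPP]; linarith
  have JPlim : Filter.Tendsto JP (nhdsWithin 0 (Set.Ioi 0)) Filter.atBot := by
    have c0 : 0 < C / (1 - n₂) := div_pos hC (by linarith)
    have h1 : Filter.Tendsto (fun z => -(C / (1 - n₂) * I z)) (nhdsWithin 0 (Set.Ioi 0)) Filter.atBot :=
      Filter.tendsto_neg_atTop_atBot.comp (hI0.const_mul_atTop c0)
    refine Filter.tendsto_atBot_mono' _ ?_ h1
    filter_upwards [self_mem_nhdsWithin] with z hz
    have hz : 0 < z := hz
    have t1 := mul_lt_mul_of_pos_left (bA z hz) (Real.rpow_pos_of_pos hz (n₂ - 1))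
    have e2 : z ^ (n₂ - 1) * z ^ (1 - n₂) = 1 := by
      rw [← Real.rpow_add hz, ← Real.rpow_zero z]; congr 1; ring
    have t2 : I z < (1 - n₂) * (z ^ (n₂ - 1) * A z) := by
      have : z ^ (n₂ - 1) * (I z * z ^ (1 - n₂)) = I z := by linear_combination I z * e2
      linarith
    have t3 := mul_lt_mul_of_pos_left t2 c0
    have e4 : C / (1 - n₂) * ((1 - n₂) * (z ^ (n₂ - 1) * A z)) = C * (z ^ (n₂ - 1) * A z) := by
      have : 1 - n₂ ≠ 0 := by linarith
      field_simp
    have t5 := mul_nonneg hC.le (mul_nonneg (Real.rpow_pos_of_pos hz (n₁ - 1)).le (B0 z hz))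
    simp only [hJP]; linarith
  -- R
  set RP : ℝ → ℝ := fun z => C * (n₂ * z ^ (n₂ - 1) * (Mh2 z - Mh2 zR) + n₁ * z ^ (n₁ - 1) * (Mh1 z - Mh1 zR)) with hRP
  set RPP : ℝ → ℝ := fun z => C * (n₂ * (n₂ - 1) * z ^ (n₂ - 2) * (Mh2 z - Mh2 zR) + n₁ * (n₁ - 1) * z ^ (n₁ - 2) * (Mh1 z - Mh1 zR) + (n₂ - n₁) * h z * z ^ (-2 : ℝ)) with hRPP
  have dR : ∀ z, 0 < z → HasDerivAt R (RP z) z := by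
    intro z hz
    have := (aux_L n₁ n₂ (Mh1 zR) (Mh2 zR) (h z) z Mh1 Mh2 hz (dMh1 z hz) (dMh2 z hz)).const_mul C
    refine this.congr_of_eventuallyEq ?_
    filter_upwards [Ioi_mem_nhds hz] with x hx
    exact hR x hx
  have dRP : ∀ z, 0 < z → HasDerivAt RP (RPP z) z := by
    intro z hz
    exact (aux_L2 n₁ n₂ (Mh1 zR) (Mh2 zR) (h z) z Mh1 Mh2 hz (dMh1 z hz) (dMh2 z hz)).const_mul C
  have m2 : ∀ z, 0 < z → z ≤ zB → n₂ * (Mh2 z - Mh2 zR) = - z ^ (-n₂) * h z + A z - ∫ η in z..zB, η ^ (-n₂) * G η := by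
    intro z hz hzz
    have := aux_Ioo_add _ z zB hz hzz (iG2 zB hzB)
    have c := ch2 z hz
    simp only [hK2] at c
    linarith
  have m1 : ∀ z, 0 < z → z ≤ zB → n₁ * (Mh1 z - Mh1 zR) = z ^ (-n₁) * h z + B z + ∫ η in z..zB, η ^ (-n₁) * G η := by
    intro z hz hzz
    have := aux_Ioi_sub _ z zB hzz (iG1 z hz)
    have c := ch1 z hz
    simp only [hK1] at c
    linarith
  have QPB : RP zB + JP zB = 0 := by
    have a1 := m1 zB hzB le_rfl
    have a2 := m2 zB hzB le_rfl
    rw [intervalIntegral.integral_same] at a1 a2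
    have e1 : zB ^ (n₁ - 1) * zB ^ (-n₁) = zB⁻¹ := by
      rw [← Real.rpow_add hzB, ← Real.rpow_neg_one]; congr 1; ring
    have e2 : zB ^ (n₂ - 1) * zB ^ (-n₂) = zB⁻¹ := by
      rw [← Real.rpow_add hzB, ← Real.rpow_neg_one]; congr 1; ring
    simp only [hRP, hJP]
    linear_combination C * zB ^ (n₂ - 1) * a2 + C * zB ^ (n₁ - 1) * a1 + C * h zB * e1 - C * h zB * e2
  have QPPeq : ∀ z, 0 < z → z ≤ zB → RPP z + JPP z = C * ((n₁ - 1) * z ^ (n₁ - 2) * (∫ η in z..zB, η ^ (-n₁) * G η) +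
      (1 - n₂) * z ^ (n₂ - 2) * (∫ η in z..zB, η ^ (-n₂) * G η)) := by
    intro z hz hzz
    have a1 := m1 z hz hzz
    have a2 := m2 z hz hzz
    have e1 : z ^ (n₁ - 2) * z ^ (-n₁) = z ^ (-2 : ℝ) := by
      rw [← Real.rpow_add hz]; congr 1; ring
    have e2 : z ^ (n₂ - 2) * z ^ (-n₂) = z ^ (-2 : ℝ) := by
      rw [← Real.rpow_add hz]; congr 1; ring
    simp only [hRPP, hJPP]
    rw [show n₁ - 1 - 1 = n₁ - 2 by ring, show n₂ - 1 - 1 = n₂ - 2 by ring]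
    linear_combination C * (n₂ - 1) * z ^ (n₂ - 2) * a2 + C * (n₁ - 1) * z ^ (n₁ - 2) * a1 + C * (n₁ - 1) * h z * e1 - C * (n₂ - 1) * h z * e2
  have RPPR : 0 < RPP zR := by
    have : RPP zR = C * ((n₁ - n₂) * (-h zR) * zR ^ (-2 : ℝ)) := by
      simp only [hRPP]; ring
    rw [this]
    exact mul_pos hC (mul_pos (mul_pos (by linarith) (by linarith)) (Real.rpow_pos_of_pos hzR _))
  have QPPpos : ∀ z, zR ≤ z → z < zB → 0 < RPP z + JPP z := by
    intro z hz hzz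
    rw [QPPeq z (by linarith) hzz.le]
    refine mul_pos hC (aux_S n₁ n₂ zR zB z hn₂ hn₁ G hG hzR hz hzz ?_)
    have h1 : 0 < RPP zR + JPP zR := add_pos RPPR (JPPpos zR hzR)
    rw [QPPeq zR hzR hRB.le] at h1
    exact pos_of_mul_pos_right h1 hC.le
  have RPR : RP zR = 0 := by simp [hRP]
  -- monotonicity
  have mono1 : StrictMonoOn JP (Set.Ioc 0 zR) := by
    refine strictMonoOn_of_deriv_pos (convex_Ioc _ _) (fun x hx => (dJP x hx.1).continuousAt.continuousWithinAt) ?_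
    intro x hx
    rw [interior_Ioc] at hx
    rw [(dJP x hx.1).deriv]; exact JPPpos x hx.1
  have mono2 : StrictMonoOn (fun z => RP z + JP z) (Set.Ico zR zB) := by
    refine strictMonoOn_of_deriv_pos (convex_Ico _ _)
      (fun x hx => ((dRP x (hzR.trans_le hx.1)).add (dJP x (hzR.trans_le hx.1))).continuousAt.continuousWithinAt) ?_
    intro x hx
    rw [interior_Ico] at hx
    have := ((dRP x (hzR.trans hx.1)).add (dJP x (hzR.trans hx.1))).deriv
    have e : deriv (fun z => RP z + JP z) x = RPP x + JPP x := this
    rw [e]; exact QPPpos x hx.1.le hx.2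
  set D : ℝ → ℝ := fun z => if z ≤ zR then JP z else RP z + JP z with hD
  have D1 : ∀ z, z ≤ zR → D z = JP z := fun z hz => if_pos hz
  have D2 : ∀ z, zR ≤ z → D z = RP z + JP z := by
    intro z hz
    rcases hz.eq_or_lt with rfl | h'
    · rw [D1 _ le_rfl, RPR, zero_add]
    · exact if_neg (not_le.2 h')
  have Dmono : StrictMonoOn D (Set.Ioo 0 zB) := by
    have s1 : StrictMonoOn D (Set.Ioc 0 zR) := mono1.congr fun x hx => (D1 x hx.2).symm
    have s2 : StrictMonoOn D (Set.Ico zR zB) := mono2.congr fun x hx => (D2 x hx.1).symm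
    have := s1.union s2 (isGreatest_Ioc hzR) (isLeast_Ico hRB)
    rwa [Set.Ioc_union_Ico_eq_Ioo hzR hRB] at this
  have dQ : ∀ z, 0 < z → z < zB → HasDerivAt Q (D z) z := by
    intro z hz hzz
    rcases lt_trichotomy z zR with hlt | heq | hgt
    · rw [D1 z hlt.le]
      refine (dJ z hz).congr_of_eventuallyEq ?_
      filter_upwards [Ioo_mem_nhds hz hlt] with x hx
      exact hQ₁ x hx.1 hx.2.le
    · subst heq
      have l : HasDerivWithinAt Q (D z) (Set.Iic z) z := by
        rw [D1 z le_rfl]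
        refine (dJ z hz).hasDerivWithinAt.congr_of_eventuallyEq ?_ (hQ₁ z hz le_rfl)
        filter_upwards [self_mem_nhdsWithin, mem_nhdsWithin_of_mem_nhds (Ioi_mem_nhds hz)] with x hx hx'
        exact hQ₁ x hx' hx
      have r : HasDerivWithinAt Q (D z) (Set.Ici z) z := by
        rw [D2 z le_rfl]
        refine ((dR z hz).add (dJ z hz)).hasDerivWithinAt.congr_of_eventuallyEq ?_ (hQ₂ z le_rfl hzz.le)
        filter_upwards [self_mem_nhdsWithin, mem_nhdsWithin_of_mem_nhds (Iio_mem_nhds hzz)] with x hx hx'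
        exact hQ₂ x hx (le_of_lt hx')
      have := l.union r
      rwa [Set.Iic_union_Ici, hasDerivWithinAt_univ] at this
    · rw [D2 z hgt.le]
      refine ((dR z hz).add (dJ z hz)).congr_of_eventuallyEq ?_
      filter_upwards [Ioo_mem_nhds hgt hzz] with x hx
      exact hQ₂ x hx.1.le hx.2.le
  refine ⟨?_, ?_, ?_⟩
  · refine StrictMonoOn.strictConvexOn_of_deriv (convex_Ioo _ _)
      (fun x hx => (dQ x hx.1 hx.2).continuousAt.continuousWithinAt) ?_
    rw [interior_Ioo]
    exact Dmono.congr fun x hx => (dQ x hx.1 hx.2).deriv.symm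
  · have h1 : Filter.Tendsto (fun z => RP z + JP z) (nhdsWithin zB (Set.Iio zB)) (nhds 0) := by
      have := ((dRP zB hzB).add (dJP zB hzB)).continuousAt.tendsto.mono_left (nhdsWithin_le_nhds (s := Set.Iio zB))
      rw [Pi.add_apply, QPB] at this
      exact this
    refine h1.congr' ?_
    filter_upwards [Ioo_mem_nhdsLT hRB] with x hx
    rw [(dQ x (hzR.trans hx.1) hx.2).deriv, D2 x hx.1.le]
  · refine JPlim.congr' ?_
    filter_upwards [Ioo_mem_nhdsGT hzR] with x hx
    rw [(dQ x hx.1 (hx.2.trans hRB)).deriv, D1 x hx.2.le]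

lemma aux_dual (u u' I utld : ℝ → ℝ)
    (hu_conc : StrictConcaveOn ℝ (Set.Ici 0) u)
    (hu_deriv : ∀ c : ℝ, 0 < c → HasDerivAt u (u' c) c)
    (hI_pos : ∀ y : ℝ, 0 < y → 0 < I y)
    (hI_left : ∀ y : ℝ, 0 < y → u' (I y) = y)
    (hutld : ∀ y : ℝ, 0 < y → utld y = u (I y) - y * I y) (y x : ℝ) (hy : 0 < y) (hx : 0 < x) :
    utld y - (x - y) * I y ≤ utld x := by
  have key : u (I y) ≤ u (I x) + x * (I y - I x) := by
    have hd := hu_deriv (I x) (hI_pos x hx)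
    rw [hI_left x hx] at hd
    have p1 : I y ∈ Set.Ici (0:ℝ) := (hI_pos y hy).le
    have p2 : I x ∈ Set.Ici (0:ℝ) := (hI_pos x hx).le
    rcases lt_trichotomy (I x) (I y) with h | h | h
    · have := hu_conc.concaveOn.slope_le_of_hasDerivAt p2 p1 h hd
      rw [slope_def_field, div_le_iff₀ (by linarith)] at this
      linarith
    · rw [h]; simp
    · have := hu_conc.concaveOn.le_slope_of_hasDerivAt p1 p2 h hd
      rw [slope_def_field, le_div_iff₀ (by linarith)] at this
      linarith
  rw [hutld y hy, hutld x hx]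
  linarith

lemma aux_dual_deriv (I U : ℝ → ℝ) (hI_cont : ContinuousOn I (Set.Ioi 0))
    (hd : ∀ y x, 0 < y → 0 < x → U y - (x - y) * I y ≤ U x) (y : ℝ) (hy : 0 < y) :
    HasDerivAt U (-I y) y := by
  rw [hasDerivAt_iff_isLittleO, Asymptotics.isLittleO_iff]
  intro c hc
  have hc1 : ContinuousAt I y := hI_cont.continuousAt (Ioi_mem_nhds hy)
  filter_upwards [Ioi_mem_nhds hy, Metric.continuousAt_iff'.1 hc1 c hc] with x hx hxI
  have h1 := hd y x hy hx
  have h2 := hd x y hx hy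
  rw [Real.dist_eq] at hxI
  simp only [smul_eq_mul, Real.norm_eq_abs]
  have e1 : 0 ≤ U x - U y - (x - y) * -I y := by linarith
  have e2 : U x - U y - (x - y) * -I y ≤ -((x - y) * (I x - I y)) := by linarith
  rw [abs_of_nonneg e1]
  calc _ ≤ _ := e2
    _ ≤ |(x - y) * (I x - I y)| := neg_le_abs _
    _ = |I x - I y| * |x - y| := by rw [abs_mul, mul_comm]
    _ ≤ c * |x - y| := mul_le_mul_of_nonneg_right hxI.le (abs_nonneg _)

/-- Q is strictly convex on (0,z_B), with lim_{z→z_B−} Q′(z) = 0 and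
lim_{z→0+} Q′(z) = −∞. -/
theorem stmt_18
    (δ r θ n₁ n₂ : ℝ)
    (hδ : 0 < δ) (hr : 0 < r) (hθ : θ ≠ 0)
    (hn₂0 : n₂ < 0) (hn₁1 : 1 < n₁)
    (hroot₁ : θ ^ 2 / 2 * n₁ ^ 2 + (δ - r - θ ^ 2 / 2) * n₁ - δ = 0)
    (hroot₂ : θ ^ 2 / 2 * n₂ ^ 2 + (δ - r - θ ^ 2 / 2) * n₂ - δ = 0)
    (u u' I utld : ℝ → ℝ)
    (hu_mono : StrictMonoOn u (Set.Ici 0))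
    (hu_conc : StrictConcaveOn ℝ (Set.Ici 0) u)
    (hu_cont : ContinuousOn u (Set.Ici 0))
    (hu_deriv : ∀ c : ℝ, 0 < c → HasDerivAt u (u' c) c)
    (hu'_cont : ContinuousOn u' (Set.Ioi 0))
    (hu'_top : Filter.Tendsto u' Filter.atTop (nhds 0))
    (hu'_zero : Filter.Tendsto u' (nhdsWithin 0 (Set.Ioi 0)) Filter.atTop)
    (hI_pos : ∀ y : ℝ, 0 < y → 0 < I y)
    (hI_left : ∀ y : ℝ, 0 < y → u' (I y) = y)
    (hI_right : ∀ c : ℝ, 0 < c → I (u' c) = c)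
    (hI_anti : StrictAntiOn I (Set.Ioi 0))
    (hI_cont : ContinuousOn I (Set.Ioi 0))
    (hI_zero : Filter.Tendsto I (nhdsWithin 0 (Set.Ioi 0)) Filter.atTop)
    (hI_top : Filter.Tendsto I Filter.atTop (nhds 0))
    (hutld : ∀ y : ℝ, 0 < y → utld y = u (I y) - y * I y)
    (ε₁ ε₂ κ₁ κ₂ : ℝ)
    (hε₂ : 0 < ε₂) (hε₁₂ : ε₂ < ε₁)
    (hκ₁ : 0 < κ₁) (hκ₁₂ : κ₁ < κ₂) (hκ₂ : κ₂ < 1)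
    (z_S : ℝ) (hzS_pos : 0 < z_S)
    (hzS_zero : (1 / z_S) * (utld (z_S / κ₁) - utld (z_S / κ₂) + z_S * (ε₁ - ε₂)) = 0)
    (hzS_uniq : ∀ y : ℝ, 0 < y →
      (1 / y) * (utld (y / κ₁) - utld (y / κ₂) + y * (ε₁ - ε₂)) = 0 → y = z_S)
    (h : ℝ → ℝ)
    (hh₁ : ∀ z : ℝ, z_S < z → h z = utld (z / κ₁) - utld z + ε₁ * z)
    (hh₂ : ∀ z : ℝ, 0 < z → z ≤ z_S → h z = utld (z / κ₂) - utld z + ε₂ * z)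
    (zhat : ℝ) (hzhat_pos : 0 < zhat) (hzhat_zero : h zhat = 0)
    (hzhat_uniq : ∀ z : ℝ, 0 < z → h z = 0 → z = zhat)
    (hI_int : ∀ y : ℝ, 0 < y →
      MeasureTheory.IntegrableOn (fun η => η ^ (-n₂) * I η) (Set.Ioo 0 y) MeasureTheory.volume)
    (chat ehat : ℝ → ℝ)
    (hchat₁ : ∀ η : ℝ, z_S < η → chat η = (1 / κ₁) * I (η / κ₁))
    (hchat₂ : ∀ η : ℝ, 0 < η → η ≤ z_S → chat η = (1 / κ₂) * I (η / κ₂))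
    (hehat₁ : ∀ η : ℝ, z_S < η → ehat η = ε₁)
    (hehat₂ : ∀ η : ℝ, 0 < η → η ≤ z_S → ehat η = ε₂)
    (φ₁ φ₂ : ℝ → ℝ → ℝ)
    (hφ₁ : ∀ z₁ z₂ : ℝ, 0 < z₁ → 0 < z₂ →
      φ₁ z₁ z₂ = (∫ η in Set.Ioi z₂, η ^ (-n₁) * (ehat η - chat η)) -
        n₁ * ∫ η in Set.Ioi z₁, η ^ (-n₁ - 1) * h η)
    (hφ₂ : ∀ z₁ z₂ : ℝ, 0 < z₁ → 0 < z₂ →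
      φ₂ z₁ z₂ = (∫ η in Set.Ioo 0 z₂, η ^ (-n₂) * (ehat η - chat η)) -
        n₂ * ∫ η in Set.Ioo 0 z₁, η ^ (-n₂ - 1) * h η)
    (J_R : ℝ → ℝ)
    (hJR : ∀ y : ℝ, 0 < y → J_R y = (2 / (θ ^ 2 * (n₁ - n₂))) *
      (y ^ n₂ * (∫ η in Set.Ioo 0 y, η ^ (-n₂ - 1) * utld η) +
       y ^ n₁ * ∫ η in Set.Ioi y, η ^ (-n₁ - 1) * utld η))
    (z_R z_B : ℝ) (hzR_pos : 0 < z_R) (hzR_lt : z_R < zhat) (hzRB : z_R < z_B)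
    (hφ₁RB : φ₁ z_R z_B = 0) (hφ₂RB : φ₂ z_R z_B = 0)
    (E₁ E₂ : ℝ)
    (hE₁ : E₁ = -(2 / (θ ^ 2 * (n₁ - n₂))) * ∫ η in Set.Ioi z_R, η ^ (-n₁ - 1) * h η)
    (hE₂ : E₂ = -(2 / (θ ^ 2 * (n₁ - n₂))) * ∫ η in Set.Ioo 0 z_R, η ^ (-n₂ - 1) * h η)
    (Ψ : ℝ → ℝ)
    (hΨ : ∀ z : ℝ, 0 < z → Ψ z = (2 / (θ ^ 2 * (n₁ - n₂))) *
      (z ^ n₂ * (∫ η in Set.Ioo 0 z, η ^ (-n₂ - 1) * h η) +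
       z ^ n₁ * ∫ η in Set.Ioi z, η ^ (-n₁ - 1) * h η))
    (Q : ℝ → ℝ)
    (hQ₁ : ∀ z : ℝ, 0 < z → z ≤ z_R → Q z = J_R z)
    (hQ₂ : ∀ z : ℝ, z_R ≤ z → z ≤ z_B → Q z = E₁ * z ^ n₁ + E₂ * z ^ n₂ + Ψ z + J_R z)
    (hQ₃ : ∀ z : ℝ, z_B ≤ z → Q z = E₁ * z_B ^ n₁ + E₂ * z_B ^ n₂ + Ψ z_B + J_R z_B)
    :
    StrictConvexOn ℝ (Set.Ioo 0 z_B) Q ∧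
    Filter.Tendsto (deriv Q) (nhdsWithin z_B (Set.Iio z_B)) (nhds 0) ∧
    Filter.Tendsto (deriv Q) (nhdsWithin 0 (Set.Ioi 0)) Filter.atBot := by
  have hzB_pos : 0 < z_B := hzR_pos.trans hzRB
  have hκ₂0 : 0 < κ₂ := hκ₁.trans hκ₁₂
  have hκ₁1 : κ₁ < 1 := hκ₁₂.trans hκ₂
  have hd := aux_dual u u' I utld hu_conc hu_deriv hI_pos hI_left hutld
  have hU := aux_dual_deriv I utld hI_cont hd
  have hUc : ContinuousOn utld (Set.Ioi 0) := fun x hx => (hU x hx).continuousAt.continuousWithinAt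
  set G : ℝ → ℝ := fun η => ehat η - chat η with hGdef
  have G1 : ∀ η, z_S < η → G η = ε₁ - (1 / κ₁) * I (η / κ₁) := by
    intro η hη; simp only [hGdef]; rw [hehat₁ η hη, hchat₁ η hη]
  have G2 : ∀ η, 0 < η → η ≤ z_S → G η = ε₂ - (1 / κ₂) * I (η / κ₂) := by
    intro η hη hη'; simp only [hGdef]; rw [hehat₂ η hη hη', hchat₂ η hη hη']
  have hUk : ∀ κ ε : ℝ, 0 < κ → ∀ z, 0 < z →
      HasDerivAt (fun z => utld (z / κ) + ε * z) (ε - (1 / κ) * I (z / κ)) z := by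
    intro κ ε hκ z hz
    have h1 := (hU (z / κ) (div_pos hz hκ)).comp z ((hasDerivAt_id z).div_const κ)
    have h2 := h1.add ((hasDerivAt_id z).const_mul ε)
    refine h2.congr_deriv ?_
    ring
  -- the switching function
  set d : ℝ → ℝ := fun y => (utld (y / κ₁) + ε₁ * y) - (utld (y / κ₂) + ε₂ * y) with hd_def
  have dd : ∀ z, 0 < z → HasDerivAt d ((ε₁ - (1 / κ₁) * I (z / κ₁)) - (ε₂ - (1 / κ₂) * I (z / κ₂))) z :=
    fun z hz => (hUk κ₁ ε₁ hκ₁ z hz).sub (hUk κ₂ ε₂ hκ₂0 z hz)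
  have dzS : d z_S = 0 := by
    have h1 : (1 / z_S) ≠ 0 := by positivity
    have := (mul_eq_zero.1 hzS_zero).resolve_left h1
    simp only [hd_def]; linarith
  have duniq : ∀ y, 0 < y → d y = 0 → y = z_S := by
    intro y hy h0
    apply hzS_uniq y hy
    have : utld (y / κ₁) - utld (y / κ₂) + y * (ε₁ - ε₂) = 0 := by
      simp only [hd_def] at h0; linarith
    rw [this, mul_zero]
  have dpos : ∀ y, z_S < y → 0 < d y := by
    intro y hy
    by_contra hcon
    push Not at hcon
    have hy0 : 0 < y := hzS_pos.trans hy
    have hk : 0 < 1 / κ₁ - 1 / κ₂ := sub_pos.2 (one_div_lt_one_div_of_lt hκ₁ hκ₁₂)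
    have t1 : Filter.Tendsto (fun x => I (x / κ₂)) Filter.atTop (nhds 0) :=
      hI_top.comp (Filter.tendsto_id.atTop_div_const hκ₂0)
    have t2 : ∀ᶠ x in Filter.atTop, I (x / κ₂) < (ε₁ - ε₂) / (1 / κ₁ - 1 / κ₂) :=
      t1.eventually_lt_const (div_pos (by linarith) hk)
    obtain ⟨x, hx1, hx2⟩ := (t2.and (Filter.eventually_ge_atTop y)).exists
    have hx0 : 0 < x := hy0.trans_le hx2
    rw [lt_div_iff₀ hk] at hx1
    have h3 := hd (x / κ₂) (x / κ₁) (div_pos hx0 hκ₂0) (div_pos hx0 hκ₁)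
    have h4 : 0 < d x := by
      have h5 := mul_pos hx0 (sub_pos.2 hx1)
      have e : (x / κ₁ - x / κ₂) * I (x / κ₂) = x * (I (x / κ₂) * (1 / κ₁ - 1 / κ₂)) := by ring
      simp only [hd_def]; linarith
    have hc : ContinuousOn d (Set.Icc y x) := fun w hw =>
      (dd w (hy0.trans_le hw.1)).continuousAt.continuousWithinAt
    obtain ⟨w, hw, hw0⟩ := intermediate_value_Icc hx2 hc ⟨hcon, h4.le⟩
    have := duniq w (hy0.trans_le hw.1) hw0
    linarith [hw.1]
  have hjump : ε₂ - (1 / κ₂) * I (z_S / κ₂) ≤ ε₁ - (1 / κ₁) * I (z_S / κ₁) := by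
    have h1 := (dd z_S hzS_pos).hasDerivWithinAt (s := Set.Ioi z_S)
    rw [hasDerivWithinAt_iff_tendsto_slope' (by simp)] at h1
    have : 0 ≤ (ε₁ - (1 / κ₁) * I (z_S / κ₁)) - (ε₂ - (1 / κ₂) * I (z_S / κ₂)) := by
      refine ge_of_tendsto h1 ?_
      filter_upwards [self_mem_nhdsWithin] with x hx
      rw [slope_def_field, dzS, sub_zero]
      exact (div_pos (dpos x hx) (sub_pos.2 hx)).le
    linarith
  have kmono : ∀ κ ε : ℝ, 0 < κ → ∀ x y, 0 < x → x < y →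
      ε - (1 / κ) * I (x / κ) < ε - (1 / κ) * I (y / κ) := by
    intro κ ε hκ x y hx hxy
    have h1 : I (y / κ) < I (x / κ) :=
      hI_anti (div_pos hx hκ) (div_pos (hx.trans hxy) hκ) (div_lt_div_of_pos_right hxy hκ)
    have := mul_lt_mul_of_pos_left h1 (one_div_pos.2 hκ)
    linarith
  have hG : StrictMonoOn G (Set.Ioi 0) := by
    intro x hx y hy hxy
    have hx : 0 < x := hx
    have hy : 0 < y := hy
    rcases lt_or_ge z_S x with h1 | h1
    · rw [G1 x h1, G1 y (h1.trans hxy)]; exact kmono κ₁ ε₁ hκ₁ x y hx hxy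
    · rcases lt_or_ge z_S y with h2 | h2
      · rw [G2 x hx h1, G1 y h2]
        have a2 := kmono κ₁ ε₁ hκ₁ z_S y hzS_pos h2
        rcases h1.eq_or_lt with h3 | h3
        · rw [h3]; linarith
        · have a1 := kmono κ₂ ε₂ hκ₂0 x z_S hx h3
          linarith
      · rw [G2 x hx h1, G2 y hy h2]; exact kmono κ₂ ε₂ hκ₂0 x y hx hxy
  have hGm : ∀ s ⊆ Set.Ioi (0:ℝ), MeasurableSet s → AEStronglyMeasurable G (volume.restrict s) := by
    intro s hs hms
    exact (aemeasurable_restrict_of_monotoneOn hms (hG.monotoneOn.mono hs)).aestronglyMeasurable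
  have hGb : ∀ η, 0 < η → |G η| ≤ ε₁ + (1 / κ₁) * I η := by
    intro η hη
    have kb : ∀ κ ε : ℝ, κ₁ ≤ κ → κ < 1 → 0 < ε → ε ≤ ε₁ →
        |ε - (1 / κ) * I (η / κ)| ≤ ε₁ + (1 / κ₁) * I η := by
      intro κ ε h1 h2 h3 h4
      have hκ : 0 < κ := hκ₁.trans_le h1
      have i1 : I (η / κ) ≤ I η := by
        apply hI_anti.antitoneOn hη (div_pos hη hκ)
        rw [le_div_iff₀ hκ]; nlinarith
      have i2 : 1 / κ ≤ 1 / κ₁ := one_div_le_one_div_of_le hκ₁ h1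
      have i3 := hI_pos _ (div_pos hη hκ)
      have i4 : (1 / κ) * I (η / κ) ≤ (1 / κ₁) * I η := mul_le_mul i2 i1 i3.le (one_div_pos.2 hκ₁).le
      have i5 : 0 < (1 / κ) * I (η / κ) := mul_pos (one_div_pos.2 hκ) i3
      rw [abs_le]; constructor <;> linarith
    rcases lt_or_ge z_S η with h1 | h1
    · rw [G1 η h1]; exact kb κ₁ ε₁ le_rfl hκ₁1 (by linarith) le_rfl
    · rw [G2 η hη h1]; exact kb κ₂ ε₂ hκ₁₂.le hκ₂ hε₂ hε₁₂.le
  have hpm : ∀ (n : ℝ) (s : Set ℝ), AEStronglyMeasurable (fun η : ℝ => η ^ n) (volume.restrict s) :=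
    fun n s => (measurable_id.pow_const _).aestronglyMeasurable
  have hIm : ∀ s ⊆ Set.Ioi (0:ℝ), MeasurableSet s → AEStronglyMeasurable I (volume.restrict s) :=
    fun s hs hms => (hI_cont.mono hs).aestronglyMeasurable hms
  have iI1 : ∀ z, 0 < z → IntegrableOn (fun η => η ^ (-n₁) * I η) (Set.Ioi z) := by
    intro z hz
    have hs : Set.Ioi z ⊆ Set.Ioi 0 := Set.Ioi_subset_Ioi hz.le
    have i0 : IntegrableOn (fun η : ℝ => η ^ (-n₁) * I z) (Set.Ioi z) :=
      (integrableOn_Ioi_rpow_of_lt (by linarith) hz).mul_const _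
    refine Integrable.mono' i0 ((hpm _ _).mul (hIm _ hs measurableSet_Ioi)) ?_
    filter_upwards [ae_restrict_mem measurableSet_Ioi] with x hx
    have hx0 : 0 < x := hz.trans hx
    have hp := Real.rpow_pos_of_pos hx0 (-n₁)
    rw [Real.norm_eq_abs, abs_of_pos (mul_pos hp (hI_pos x hx0))]
    exact mul_le_mul_of_nonneg_left (hI_anti hz hx0 hx).le hp.le
  have iGgen : ∀ (n : ℝ) (s : Set ℝ), s ⊆ Set.Ioi 0 → MeasurableSet s →
      IntegrableOn (fun η : ℝ => η ^ n) s → IntegrableOn (fun η => η ^ n * I η) s →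
      IntegrableOn (fun η => η ^ n * G η) s := by
    intro n s hs hms i1 i2
    refine Integrable.mono' ((i1.mul_const ε₁).add (i2.mul_const (1 / κ₁))) ((hpm _ _).mul (hGm _ hs hms)) ?_
    filter_upwards [ae_restrict_mem hms] with x hx
    have hx0 : 0 < x := hs hx
    have hp := Real.rpow_pos_of_pos hx0 n
    rw [Real.norm_eq_abs, abs_mul, abs_of_pos hp]
    have := mul_le_mul_of_nonneg_left (hGb x hx0) hp.le
    simp only [Pi.add_apply]
    linarith
  have iG1 : ∀ z, 0 < z → IntegrableOn (fun η => η ^ (-n₁) * G η) (Set.Ioi z) := fun z hz =>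
    iGgen _ _ (Set.Ioi_subset_Ioi hz.le) measurableSet_Ioi
      (integrableOn_Ioi_rpow_of_lt (by linarith) hz) (iI1 z hz)
  have iG2 : ∀ z, 0 < z → IntegrableOn (fun η => η ^ (-n₂) * G η) (Set.Ioo 0 z) := by
    intro z hz
    refine iGgen _ _ Set.Ioo_subset_Ioi_self measurableSet_Ioo ?_ (hI_int z hz)
    have := (intervalIntegral.intervalIntegrable_rpow' (a := 0) (b := z) (r := -n₂) (by linarith))
    rwa [intervalIntegrable_iff_integrableOn_Ioo_of_le hz.le] at this
  -- h
  have hk1 : ∀ z, z_S ≤ z → h z = utld (z / κ₁) + ε₁ * z - utld z := by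
    intro z hz
    rcases hz.eq_or_lt with h1 | h1
    · subst h1
      rw [hh₂ z_S hzS_pos le_rfl]
      simp only [hd_def] at dzS; linarith
    · rw [hh₁ z h1]; ring
  have hk2 : ∀ z, 0 < z → z ≤ z_S → h z = utld (z / κ₂) + ε₂ * z - utld z := by
    intro z hz hz'
    rw [hh₂ z hz hz']; ring
  have hdl : ∀ κ ε : ℝ, 0 < κ → ∀ z, 0 < z →
      HasDerivAt (fun z => utld (z / κ) + ε * z - utld z) (ε - (1 / κ) * I (z / κ) + I z) z := by
    intro κ ε hκ z hz
    refine ((hUk κ ε hκ z hz).sub (hU z hz)).congr_deriv ?_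
    ring
  have hhd : ∀ z, 0 < z → z ≠ z_S → HasDerivAt h (G z + I z) z := by
    intro z hz hne
    rcases lt_or_gt_of_ne hne with h1 | h1
    · rw [G2 z hz h1.le]
      refine (hdl κ₂ ε₂ hκ₂0 z hz).congr_of_eventuallyEq ?_
      filter_upwards [Ioo_mem_nhds hz h1] with x hx
      exact hk2 x hx.1 hx.2.le
    · rw [G1 z h1]
      refine (hdl κ₁ ε₁ hκ₁ z hz).congr_of_eventuallyEq ?_
      filter_upwards [Ioi_mem_nhds h1] with x hx
      exact hk1 x (le_of_lt hx)
  have hhca : ∀ z, 0 < z → ContinuousAt h z := by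
    intro z hz
    by_cases hne : z = z_S
    · subst hne
      rw [continuousAt_iff_continuous_left_right]
      constructor
      · refine (hdl κ₂ ε₂ hκ₂0 z hz).continuousAt.continuousWithinAt.congr_of_eventuallyEq ?_ (hk2 z hz le_rfl)
        filter_upwards [self_mem_nhdsWithin, mem_nhdsWithin_of_mem_nhds (Ioi_mem_nhds hz)] with x hx hx'
        exact hk2 x hx' hx
      · refine (hdl κ₁ ε₁ hκ₁ z hz).continuousAt.continuousWithinAt.congr_of_eventuallyEq ?_ (hk1 z le_rfl)
        filter_upwards [self_mem_nhdsWithin] with x hx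
        exact hk1 x hx
    · exact (hhd z hz hne).continuousAt
  have hhc : ContinuousOn h (Set.Ioi 0) := fun x hx => (hhca x hx).continuousWithinAt
  have hIi : ∀ a b : ℝ, 0 < a → a ≤ b → IntervalIntegrable I volume a b := by
    intro a b ha hab
    refine (hI_cont.mono ?_).intervalIntegrable
    rw [Set.uIcc_of_le hab]; exact fun x hx => ha.trans_le hx.1
  have hGi : ∀ a b : ℝ, 0 < a → a ≤ b → IntervalIntegrable G volume a b := by
    intro a b ha hab
    refine MonotoneOn.intervalIntegrable (hG.monotoneOn.mono ?_)
    rw [Set.uIcc_of_le hab]; exact fun x hx => ha.trans_le hx.1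
  have hUi : ∀ a b, 0 < a → a ≤ b → ∫ s in a..b, -I s = utld b - utld a := by
    intro a b ha hab
    refine intervalIntegral.integral_eq_sub_of_hasDerivAt ?_ (hIi a b ha hab).neg
    intro x hx
    rw [Set.uIcc_of_le hab] at hx
    exact hU x (ha.trans_le hx.1)
  have hhi : ∀ a b, 0 < a → a ≤ b → ∫ s in a..b, (G s + I s) = h b - h a := by
    intro a b ha hab
    refine MeasureTheory.integral_eq_of_hasDerivAt_off_countable_of_le h _ hab (Set.countable_singleton z_S)
      (hhc.mono fun x hx => ha.trans_le hx.1) ?_ ((hGi a b ha hab).add (hIi a b ha hab))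
    intro x hx
    exact hhd x (ha.trans hx.1.1) hx.2
  have hneg : h z_R < 0 := by
    by_contra hcon
    push Not at hcon
    have hk : 0 < 1 / κ₂ - 1 := by
      rw [sub_pos, lt_div_iff₀ hκ₂0]; linarith
    have t0 := hI_zero.eventually_gt_atTop (ε₂ / (1 / κ₂ - 1))
    obtain ⟨x, hx1, hx2⟩ := (t0.and (Ioo_mem_nhdsGT
      (show (0:ℝ) < min z_S z_R / κ₂ from div_pos (lt_min hzS_pos hzR_pos) hκ₂0))).exists
    have hx0 : 0 < x := hx2.1
    have hxm := hx2.2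
    rw [lt_div_iff₀ hκ₂0] at hxm
    have hz0 : 0 < x * κ₂ := mul_pos hx0 hκ₂0
    have hz1 : x * κ₂ < z_S := hxm.trans_le (min_le_left _ _)
    have hz2 : x * κ₂ < z_R := hxm.trans_le (min_le_right _ _)
    have h3 : h (x * κ₂) < 0 := by
      rw [hk2 _ hz0 hz1.le, mul_div_cancel_right₀ _ hκ₂0.ne']
      have h4 := hd x (x * κ₂) hx0 hz0
      rw [div_lt_iff₀ hk] at hx1
      have h5 := mul_pos hz0 (sub_pos.2 hx1)
      have e : (x * κ₂ - x) * I x = -(x * κ₂ * (I x * (1 / κ₂ - 1))) := by field_simp; ring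
      linarith
    obtain ⟨w, hw, hw0⟩ := intermediate_value_Icc hz2.le
      (hhc.mono fun y hy => hz0.trans_le hy.1) ⟨h3.le, hcon⟩
    have := hzhat_uniq w (hz0.trans_le hw.1) hw0
    linarith [hw.2]
  have hC : 0 < 2 / (θ ^ 2 * (n₁ - n₂)) := by
    have : 0 < θ ^ 2 := by positivity
    have : 0 < n₁ - n₂ := by linarith
    positivity
  rw [hφ₁ z_R z_B hzR_pos hzB_pos] at hφ₁RB
  rw [hφ₂ z_R z_B hzR_pos hzB_pos] at hφ₂RB
  refine aux_core (2 / (θ ^ 2 * (n₁ - n₂))) n₁ n₂ hC hn₂0 hn₁1 I utld h G Q hI_pos hI_anti hI_cont hI_zero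
    hUc hhc hUi hhi hG hI_int iG2 iI1 iG1 z_R z_B hzR_pos hzRB hneg hφ₁RB hφ₂RB J_R
    (fun z => E₁ * z ^ n₁ + E₂ * z ^ n₂ + Ψ z) hJR ?_ hQ₁ hQ₂
  intro z hz
  rw [hΨ z hz, hE₁, hE₂]
  ring
end

section
/- For every x > 0 there exists a unique y* ∈ (0, z_B) such that x = −Q′(y*). -/
open MeasureTheory

theorem aux_max (u u' I utld : ℝ → ℝ)
    (hu_conc : StrictConcaveOn ℝ (Set.Ici 0) u)
    (hu_deriv : ∀ c : ℝ, 0 < c → HasDerivAt u (u' c) c)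
    (hI_pos : ∀ y : ℝ, 0 < y → 0 < I y)
    (hI_left : ∀ y : ℝ, 0 < y → u' (I y) = y)
    (hutld : ∀ y : ℝ, 0 < y → utld y = u (I y) - y * I y)
    (a c : ℝ) (ha : 0 < a) (hc : 0 ≤ c) : u c - a * c ≤ utld a := by
  have hd := hu_deriv (I a) (hI_pos a ha)
  rw [hI_left a ha] at hd
  have hp := hI_pos a ha
  rw [hutld a ha]
  rcases lt_trichotomy c (I a) with h | h | h
  · have := hu_conc.concaveOn.le_slope_of_hasDerivAt (Set.mem_Ici.2 hc) (Set.mem_Ici.2 hp.le) h hd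
    rw [slope_def_field, le_div_iff₀ (by linarith)] at this
    nlinarith
  · rw [h]
  · have := hu_conc.concaveOn.slope_le_of_hasDerivAt (Set.mem_Ici.2 hp.le) (Set.mem_Ici.2 hc) h hd
    rw [slope_def_field, div_le_iff₀ (by linarith)] at this
    nlinarith

theorem aux_deriv (I V : ℝ → ℝ) (hI_cont : ContinuousOn I (Set.Ioi 0))
    (hT : ∀ a b : ℝ, 0 < a → 0 < b → V b + (b - a) * I b ≤ V a) (a : ℝ) (ha : 0 < a) :
    HasDerivAt V (- I a) a := by
  rw [hasDerivAt_iff_isLittleO]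
  have hc : ContinuousAt I a := hI_cont.continuousAt (Ioi_mem_nhds ha)
  have hz : Filter.Tendsto (fun b => I b - I a) (nhds a) (nhds 0) := by
    have := hc.tendsto.sub_const (I a); simpa using this
  have h1 : (fun b => (I b - I a) * (b - a)) =o[nhds a] fun b => b - a := by
    have := ((Asymptotics.isLittleO_one_iff ℝ).2 hz).mul_isBigO
      (Asymptotics.isBigO_refl (fun b => b - a) (nhds a))
    simpa using this
  refine Asymptotics.IsBigO.trans_isLittleO ?_ h1
  refine Asymptotics.IsBigO.of_bound 1 ?_
  filter_upwards [Ioi_mem_nhds ha] with b hb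
  have e1 := hT a b ha hb
  have e2 := hT b a hb ha
  simp only [smul_eq_mul, one_mul, Real.norm_eq_abs]
  rw [abs_of_nonneg (by nlinarith)]
  rw [← abs_neg]
  refine le_trans ?_ (le_abs_self _)
  nlinarith

theorem aux_fin (V v : ℝ → ℝ) (s n a b : ℝ) (ha : 0 < a) (hab : a ≤ b)
    (hVc : ContinuousOn V (Set.Ioi 0))
    (hVd : ∀ η : ℝ, 0 < η → η ≠ s → HasDerivAt V (v η) η)
    (hv : MonotoneOn v (Set.Ioi 0)) :
    ∫ η in a..b, η ^ (-n) * v η = b ^ (-n) * V b - a ^ (-n) * V a +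
      n * ∫ η in a..b, η ^ (-n - 1) * V η := by
  have hsub : Set.Icc a b ⊆ Set.Ioi 0 := fun x hx => lt_of_lt_of_le ha hx.1
  have hpow : ∀ m : ℝ, ContinuousOn (fun η : ℝ => η ^ m) (Set.Icc a b) := fun m x hx =>
    (Real.continuousAt_rpow_const _ _ (Or.inl (ne_of_gt (hsub hx)))).continuousWithinAt
  have i1 : IntervalIntegrable (fun η => η ^ (-n) * v η) volume a b := by
    have : IntervalIntegrable v volume a b := by
      apply MonotoneOn.intervalIntegrable
      rw [Set.uIcc_of_le hab]; exact hv.mono hsub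
    apply this.continuousOn_mul
    rw [Set.uIcc_of_le hab]; exact hpow _
  have i2 : IntervalIntegrable (fun η => η ^ (-n - 1) * V η) volume a b := by
    apply ContinuousOn.intervalIntegrable
    rw [Set.uIcc_of_le hab]; exact (hpow _).mul (hVc.mono hsub)
  have key := MeasureTheory.integral_eq_of_hasDerivAt_off_countable_of_le
    (fun η => η ^ (-n) * V η) (fun η => η ^ (-n) * v η - n * (η ^ (-n - 1) * V η)) hab
    (Set.countable_singleton s) ((hpow _).mul (hVc.mono hsub))
    (by
      intro x hx
      have hx0 : 0 < x := lt_trans ha hx.1.1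
      have h1 := (Real.hasDerivAt_rpow_const (x := x) (p := -n) (Or.inl hx0.ne')).mul
        (hVd x hx0 hx.2)
      exact h1.congr_deriv (by ring))
    (i1.sub (i2.const_mul n))
  rw [intervalIntegral.integral_sub i1 (i2.const_mul n), intervalIntegral.integral_const_mul] at key
  linarith

theorem aux_prim0 (g : ℝ → ℝ) (z : ℝ) (hz : 0 < z) (hi : IntegrableOn g (Set.Ioo 0 z)) :
    Filter.Tendsto (fun a => ∫ η in Set.Ioo 0 a, g η) (nhdsWithin 0 (Set.Ioi 0)) (nhds 0) := by
  have h1 : IntegrableOn g (Set.uIcc 0 z) := by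
    rw [Set.uIcc_of_le hz.le, integrableOn_Icc_iff_integrableOn_Ioo]; exact hi
  have h2 := intervalIntegral.continuousOn_primitive_interval h1 0 (by simp)
  rw [Set.uIcc_of_le hz.le] at h2
  have h3 := h2.tendsto.mono_left (show nhdsWithin (0:ℝ) (Set.Ioc 0 z) ≤ _ from
    nhdsWithin_mono _ Set.Ioc_subset_Icc_self)
  rw [nhdsWithin_Ioc_eq_nhdsGT hz] at h3
  simp only [intervalIntegral.integral_same] at h3
  refine h3.congr' ?_
  filter_upwards [self_mem_nhdsWithin] with a ha
  rw [intervalIntegral.integral_of_le (le_of_lt ha), integral_Ioc_eq_integral_Ioo]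

theorem aux_split0 (g : ℝ → ℝ) (a z : ℝ) (ha : 0 < a) (haz : a ≤ z)
    (hi : IntegrableOn g (Set.Ioo 0 z)) :
    ∫ η in Set.Ioo 0 z, g η = (∫ η in Set.Ioo 0 a, g η) + ∫ η in a..z, g η := by
  have h1 : IntervalIntegrable g volume 0 z := by
    rw [intervalIntegrable_iff_integrableOn_Ioo_of_le (ha.le.trans haz)]; exact hi
  rw [← integral_Ioc_eq_integral_Ioo, ← integral_Ioc_eq_integral_Ioo,
    ← intervalIntegral.integral_of_le ha.le, ← intervalIntegral.integral_of_le (ha.le.trans haz)]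
  rw [intervalIntegral.integral_add_adjacent_intervals]
  · apply h1.mono_set
    rw [Set.uIcc_of_le ha.le, Set.uIcc_of_le (ha.le.trans haz)]
    exact Set.Icc_subset_Icc le_rfl haz
  · apply h1.mono_set
    rw [Set.uIcc_of_le haz, Set.uIcc_of_le (ha.le.trans haz)]
    exact Set.Icc_subset_Icc ha.le le_rfl

theorem aux_bp0 (V v : ℝ → ℝ) (s n z : ℝ) (hz : 0 < z)
    (hVc : ContinuousOn V (Set.Ioi 0))
    (hVd : ∀ η : ℝ, 0 < η → η ≠ s → HasDerivAt V (v η) η)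
    (hv : MonotoneOn v (Set.Ioi 0))
    (i1 : IntegrableOn (fun η => η ^ (-n) * v η) (Set.Ioo 0 z))
    (i2 : IntegrableOn (fun η => η ^ (-n - 1) * V η) (Set.Ioo 0 z))
    (hl : Filter.Tendsto (fun η => η ^ (-n) * V η) (nhdsWithin 0 (Set.Ioi 0)) (nhds 0)) :
    ∫ η in Set.Ioo 0 z, η ^ (-n) * v η = z ^ (-n) * V z +
      n * ∫ η in Set.Ioo 0 z, η ^ (-n - 1) * V η := by
  have t1 := aux_prim0 _ z hz i1
  have t2 := aux_prim0 _ z hz i2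
  have t3 := (t1.sub hl).sub (t2.const_mul n)
  have hev : (fun a => (∫ η in Set.Ioo 0 a, η ^ (-n) * v η) - a ^ (-n) * V a -
      n * ∫ η in Set.Ioo 0 a, η ^ (-n - 1) * V η) =ᶠ[nhdsWithin 0 (Set.Ioi 0)]
      fun _ => (∫ η in Set.Ioo 0 z, η ^ (-n) * v η) - z ^ (-n) * V z -
      n * ∫ η in Set.Ioo 0 z, η ^ (-n - 1) * V η := by
    filter_upwards [Ioo_mem_nhdsGT hz] with a ha
    have := aux_fin V v s n a z ha.1 ha.2.le hVc hVd hv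
    rw [aux_split0 _ a z ha.1 ha.2.le i1, aux_split0 _ a z ha.1 ha.2.le i2, this]
    ring
  have t4 := tendsto_nhds_unique (t3.congr' hev) tendsto_const_nhds
  linarith

theorem aux_bpinf (V v : ℝ → ℝ) (s n z : ℝ) (hz : 0 < z)
    (hVc : ContinuousOn V (Set.Ioi 0))
    (hVd : ∀ η : ℝ, 0 < η → η ≠ s → HasDerivAt V (v η) η)
    (hv : MonotoneOn v (Set.Ioi 0))
    (i1 : IntegrableOn (fun η => η ^ (-n) * v η) (Set.Ioi z))
    (i2 : IntegrableOn (fun η => η ^ (-n - 1) * V η) (Set.Ioi z))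
    (hl : Filter.Tendsto (fun η => η ^ (-n) * V η) Filter.atTop (nhds 0)) :
    ∫ η in Set.Ioi z, η ^ (-n) * v η = - (z ^ (-n) * V z) +
      n * ∫ η in Set.Ioi z, η ^ (-n - 1) * V η := by
  have t1 := intervalIntegral_tendsto_integral_Ioi z i1 Filter.tendsto_id
  have t2 := intervalIntegral_tendsto_integral_Ioi z i2 Filter.tendsto_id
  have t3 := (t1.sub hl).sub (t2.const_mul n)
  have hev : (fun b => (∫ η in z..(id b), η ^ (-n) * v η) - b ^ (-n) * V b -
      n * ∫ η in z..(id b), η ^ (-n - 1) * V η) =ᶠ[Filter.atTop]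
      fun _ => - (z ^ (-n) * V z) := by
    filter_upwards [Filter.eventually_ge_atTop z] with b hb
    have := aux_fin V v s n z b hz hb hVc hVd hv
    simp only [id]
    rw [this]
    ring
  have t4 := tendsto_nhds_unique (t3.congr' hev) tendsto_const_nhds
  linarith

theorem aux_dIoi (g : ℝ → ℝ) (hg : ContinuousOn g (Set.Ioi 0))
    (hi : ∀ y : ℝ, 0 < y → IntegrableOn g (Set.Ioi y)) (z : ℝ) (hz : 0 < z) :
    HasDerivAt (fun y => ∫ η in Set.Ioi y, g η) (- g z) z := by
  have h0 : 0 < z / 2 := by linarith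
  have hc : ContinuousAt g z := hg.continuousAt (Ioi_mem_nhds hz)
  have hd : HasDerivAt (fun y => ∫ η in (z/2)..y, g η) (g z) z := by
    apply intervalIntegral.integral_hasDerivAt_right
    · rw [intervalIntegrable_iff_integrableOn_Ioc_of_le (by linarith)]
      exact (hi _ h0).mono_set Set.Ioc_subset_Ioi_self
    · exact hg.stronglyMeasurableAtFilter isOpen_Ioi z hz
    · exact hc
  have := hd.const_sub (∫ η in Set.Ioi (z/2), g η)
  refine this.congr_of_eventuallyEq ?_
  filter_upwards [Ioi_mem_nhds (show z/2 < z by linarith)] with y hy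
  rw [← intervalIntegral.integral_Ioi_sub_Ioi (hi _ h0) (le_of_lt hy)]
  ring

theorem aux_dIoo (g : ℝ → ℝ) (hg : ContinuousOn g (Set.Ioi 0))
    (hi : ∀ y : ℝ, 0 < y → IntegrableOn g (Set.Ioo 0 y)) (z : ℝ) (hz : 0 < z) :
    HasDerivAt (fun y => ∫ η in Set.Ioo 0 y, g η) (g z) z := by
  have hc : ContinuousAt g z := hg.continuousAt (Ioi_mem_nhds hz)
  have hd : HasDerivAt (fun y => ∫ η in (0:ℝ)..y, g η) (g z) z := by
    apply intervalIntegral.integral_hasDerivAt_right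
    · rw [intervalIntegrable_iff_integrableOn_Ioo_of_le hz.le]
      exact (hi _ hz)
    · exact hg.stronglyMeasurableAtFilter isOpen_Ioi z hz
    · exact hc
  refine hd.congr_of_eventuallyEq ?_
  filter_upwards [Ioi_mem_nhds hz] with y hy
  rw [intervalIntegral.integral_of_le (le_of_lt hy), integral_Ioc_eq_integral_Ioo]

theorem aux_pow_cont (m : ℝ) : ContinuousOn (fun η : ℝ => η ^ m) (Set.Ioi 0) := fun x hx =>
    (Real.continuousAt_rpow_const _ _ (Or.inl (ne_of_gt hx))).continuousWithinAt

theorem aux_pow0 (m y : ℝ) (hm : -1 < m) (hy : 0 < y) :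
    IntegrableOn (fun η : ℝ => η ^ m) (Set.Ioo 0 y) := by
  have := intervalIntegral.intervalIntegrable_rpow' (a := 0) (b := y) hm
  rwa [intervalIntegrable_iff_integrableOn_Ioo_of_le hy.le] at this

theorem aux_growth (V : ℝ → ℝ) (n e y K : ℝ) (hn : 1 < n) (hy : 0 < y)
    (hVc : ContinuousOn V (Set.Ioi 0))
    (hK : ∀ η, y ≤ η → |V η| ≤ K + e * η) :
    IntegrableOn (fun η => η ^ (-n - 1) * V η) (Set.Ioi y) ∧
    Filter.Tendsto (fun η => η ^ (-n) * V η) Filter.atTop (nhds 0) := by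
  have hrel : ∀ η : ℝ, 0 < η → ∀ m : ℝ, η ^ m * η = η ^ (m + 1) := fun η hη m => by
    rw [Real.rpow_add hη, Real.rpow_one]
  constructor
  · have hi : IntegrableOn (fun η : ℝ => K * η ^ (-n - 1) + e * η ^ (-n)) (Set.Ioi y) :=
      ((integrableOn_Ioi_rpow_of_lt (by linarith) hy).const_mul K).add
        ((integrableOn_Ioi_rpow_of_lt (by linarith) hy).const_mul e)
    refine Integrable.mono' hi ?_ ?_
    · apply ContinuousOn.aestronglyMeasurable _ measurableSet_Ioi
      exact ((aux_pow_cont _).mul hVc).mono (Set.Ioi_subset_Ioi hy.le)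
    · filter_upwards [ae_restrict_mem measurableSet_Ioi] with η hη
      have h0 : 0 < η := lt_trans hy hη
      have hp : 0 < η ^ (-n - 1) := Real.rpow_pos_of_pos h0 _
      rw [norm_mul, Real.norm_eq_abs, Real.norm_eq_abs, abs_of_pos hp]
      have e1 := hrel η h0 (-n - 1)
      rw [show -n - 1 + 1 = -n by ring] at e1
      rw [← e1]
      have := mul_le_mul_of_nonneg_left (hK η (le_of_lt hη)) hp.le
      linarith
  · have l1 := tendsto_rpow_neg_atTop (y := n) (by linarith)
    have l2 := tendsto_rpow_neg_atTop (y := n - 1) (by linarith)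
    have l3 := (l1.const_mul K).add (l2.const_mul e)
    simp only [mul_zero, add_zero] at l3
    refine squeeze_zero_norm' ?_ l3
    filter_upwards [Filter.eventually_ge_atTop y] with η hη
    have h0 : 0 < η := lt_of_lt_of_le hy hη
    have hp : 0 < η ^ (-n) := Real.rpow_pos_of_pos h0 _
    rw [norm_mul, Real.norm_eq_abs, Real.norm_eq_abs, abs_of_pos hp]
    have e1 := hrel η h0 (-n)
    rw [show -n + 1 = -(n - 1) by ring] at e1
    rw [← e1]
    have := mul_le_mul_of_nonneg_left (hK η hη) hp.le
    linarith

theorem aux_vinf (v : ℝ → ℝ) (n y K : ℝ) (hn : 1 < n) (hy : 0 < y)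
    (hv : MonotoneOn v (Set.Ioi 0))
    (hK : ∀ η, y ≤ η → |v η| ≤ K) :
    IntegrableOn (fun η => η ^ (-n) * v η) (Set.Ioi y) := by
  have hi : IntegrableOn (fun η : ℝ => K * η ^ (-n)) (Set.Ioi y) :=
    ((integrableOn_Ioi_rpow_of_lt (by linarith) hy).const_mul K)
  refine Integrable.mono' hi ?_ ?_
  · apply AEStronglyMeasurable.mul
    · exact ((aux_pow_cont (-n)).mono (Set.Ioi_subset_Ioi hy.le)).aestronglyMeasurable
        measurableSet_Ioi
    · exact (aemeasurable_restrict_of_monotoneOn measurableSet_Ioi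
        (hv.mono (Set.Ioi_subset_Ioi hy.le))).aestronglyMeasurable
  · filter_upwards [ae_restrict_mem measurableSet_Ioi] with η hη
    have h0 : 0 < η := lt_trans hy hη
    have hp : 0 < η ^ (-n) := Real.rpow_pos_of_pos h0 _
    rw [norm_mul, Real.norm_eq_abs, Real.norm_eq_abs, abs_of_pos hp]
    have := mul_le_mul_of_nonneg_left (hK η (le_of_lt hη)) hp.le
    linarith

theorem aux_base0 (V I : ℝ → ℝ) (n m : ℝ) (hn : n < 0)
    (hVd : ∀ η : ℝ, 0 < η → HasDerivAt V (- I η) η)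
    (hVm : ∀ η : ℝ, 0 < η → m ≤ V η)
    (hVa : AntitoneOn V (Set.Ioi 0))
    (hIa : AntitoneOn I (Set.Ioi 0))
    (hIp : ∀ η : ℝ, 0 < η → 0 < I η)
    (hI : ∀ y : ℝ, 0 < y → IntegrableOn (fun η => η ^ (-n) * I η) (Set.Ioo 0 y)) :
    (∀ y : ℝ, 0 < y → IntegrableOn (fun η => η ^ (-n - 1) * V η) (Set.Ioo 0 y)) ∧
    Filter.Tendsto (fun η => η ^ (-n) * V η) (nhdsWithin 0 (Set.Ioi 0)) (nhds 0) := by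
  have hVc : ContinuousOn V (Set.Ioi 0) := fun x hx => (hVd x hx).continuousAt.continuousWithinAt
  have key : ∀ y : ℝ, 0 < y →
      IntegrableOn (fun η => η ^ (-n - 1) * (V η - m)) (Set.Ioo 0 y) := by
    intro y hy
    rw [← integrableOn_Ioc_iff_integrableOn_Ioo]
    have hpos : ∀ k : ℕ, 0 < y / ((k : ℝ) + 2) := fun k => by positivity
    have hle : ∀ k : ℕ, y / ((k : ℝ) + 2) ≤ y := fun k => by
      rw [div_le_iff₀ (by positivity)]
      nlinarith [Nat.cast_nonneg (α := ℝ) k]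
    refine integrableOn_Ioc_of_intervalIntegral_norm_bounded_left (l := Filter.atTop)
      (a := fun k : ℕ => y / ((k : ℝ) + 2))
      (I := (y ^ (-n) * (V y - m) + ∫ η in Set.Ioo 0 y, η ^ (-n) * I η) / (-n)) ?_ ?_ ?_
    · intro k
      rw [← integrableOn_Icc_iff_integrableOn_Ioc]
      apply ContinuousOn.integrableOn_Icc
      exact ((aux_pow_cont _).mul (hVc.sub continuousOn_const)).mono
        (fun x hx => lt_of_lt_of_le (hpos k) hx.1)
    · apply Filter.Tendsto.div_atTop tendsto_const_nhds
      exact Filter.tendsto_atTop_add_const_right _ _ tendsto_natCast_atTop_atTop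
    · refine Filter.Eventually.of_forall fun k => ?_
      have ha := hpos k
      have hb := hle k
      set a := y / ((k : ℝ) + 2) with hadef
      have e0 : ∫ x in Set.Ioc a y, ‖x ^ (-n - 1) * (V x - m)‖ =
          ∫ x in a..y, x ^ (-n - 1) * (V x - m) := by
        rw [intervalIntegral.integral_of_le hb]
        apply setIntegral_congr_fun measurableSet_Ioc
        intro x hx
        have hx0 : 0 < x := lt_trans ha hx.1
        have := hVm x hx0
        exact Real.norm_of_nonneg (mul_nonneg (Real.rpow_nonneg hx0.le _) (by linarith))
      rw [e0]
      have e1 := aux_fin (fun x => V x - m) (fun x => - I x) 0 n a y ha hb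
        (hVc.sub continuousOn_const) (fun η hη _ => (hVd η hη).sub_const m)
        (fun x hx y hy hxy => neg_le_neg (hIa hx hy hxy))
      have e2 := aux_split0 _ a y ha hb (hI y hy)
      have e3 : 0 ≤ ∫ η in Set.Ioo 0 a, η ^ (-n) * I η :=
        setIntegral_nonneg measurableSet_Ioo fun x hx =>
          mul_nonneg (Real.rpow_nonneg hx.1.le _) (hIp x hx.1).le
      have e4 : 0 ≤ a ^ (-n) * (V a - m) :=
        mul_nonneg (Real.rpow_nonneg ha.le _) (by linarith [hVm a ha])
      simp only [mul_neg, intervalIntegral.integral_neg] at e1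
      rw [le_div_iff₀ (by linarith)]
      linarith
  constructor
  · intro y hy
    have := (key y hy).add ((aux_pow0 (-n - 1) y (by linarith) hy).const_mul m)
    refine this.congr_fun (fun x hx => ?_) measurableSet_Ioo
    simp only [Pi.add_apply]; ring
  · have t1 := (aux_prim0 _ 1 one_pos (key 1 one_pos)).const_mul (-n)
    rw [mul_zero] at t1
    have t2 : Filter.Tendsto (fun η : ℝ => η ^ (-n) * (V η - m)) (nhdsWithin 0 (Set.Ioi 0))
        (nhds 0) := by
      refine tendsto_of_tendsto_of_tendsto_of_le_of_le' tendsto_const_nhds t1 ?_ ?_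
      · filter_upwards [self_mem_nhdsWithin] with y hy
        exact mul_nonneg (Real.rpow_nonneg (le_of_lt hy) _) (by linarith [hVm y hy])
      · filter_upwards [self_mem_nhdsWithin] with y hy
        have hy0 : 0 < y := hy
        have b1 : ∫ η in Set.Ioo 0 y, η ^ (-n - 1) * (V y - m) ≤
            ∫ η in Set.Ioo 0 y, η ^ (-n - 1) * (V η - m) := by
          apply setIntegral_mono_on _ (key y hy) measurableSet_Ioo
          · intro x hx
            apply mul_le_mul_of_nonneg_left _ (Real.rpow_nonneg hx.1.le _)
            linarith [hVa (Set.mem_Ioi.2 hx.1) hy hx.2.le]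
          · exact (aux_pow0 (-n - 1) y (by linarith) hy).mul_const _
        rw [integral_mul_const, ← integral_Ioc_eq_integral_Ioo,
          ← intervalIntegral.integral_of_le hy0.le, integral_rpow (Or.inl (by linarith)),
          show -n - 1 + 1 = -n by ring, Real.zero_rpow (by linarith), sub_zero] at b1
        have := mul_le_mul_of_nonneg_left b1 (show 0 ≤ -n by linarith)
        calc y ^ (-n) * (V y - m) = -n * (y ^ (-n) / -n * (V y - m)) := by
              have := hn.ne
              field_simp
          _ ≤ _ := this
    have t3 : Filter.Tendsto (fun η : ℝ => η ^ (-n)) (nhdsWithin 0 (Set.Ioi 0)) (nhds 0) := by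
      have := (Real.continuousAt_rpow_const 0 (-n) (Or.inr (by linarith))).tendsto
      rw [Real.zero_rpow (by linarith)] at this
      exact this.mono_left nhdsWithin_le_nhds
    have t4 := t2.add (t3.const_mul m)
    simp only [mul_zero, add_zero] at t4
    refine t4.congr fun x => ?_
    ring

theorem aux_dom0 (V W : ℝ → ℝ) (n K e : ℝ) (hn : n < 0)
    (hW : ContinuousOn W (Set.Ioi 0))
    (h1 : ∀ y : ℝ, 0 < y → IntegrableOn (fun η => η ^ (-n - 1) * V η) (Set.Ioo 0 y))
    (h2 : Filter.Tendsto (fun η => η ^ (-n) * V η) (nhdsWithin 0 (Set.Ioi 0)) (nhds 0))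
    (hb : ∀ η : ℝ, 0 < η → |W η| ≤ |V η| + K + e * η) :
    (∀ y : ℝ, 0 < y → IntegrableOn (fun η => η ^ (-n - 1) * W η) (Set.Ioo 0 y)) ∧
    Filter.Tendsto (fun η => η ^ (-n) * W η) (nhdsWithin 0 (Set.Ioi 0)) (nhds 0) := by
  constructor
  · intro y hy
    have hi := ((h1 y hy).norm.add ((aux_pow0 (-n - 1) y (by linarith) hy).const_mul K)).add
      ((aux_pow0 (-n) y (by linarith) hy).const_mul e)
    refine Integrable.mono' hi ?_ ?_
    · apply ContinuousOn.aestronglyMeasurable _ measurableSet_Ioo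
      exact ((aux_pow_cont _).mul hW).mono (fun x hx => hx.1)
    · filter_upwards [ae_restrict_mem measurableSet_Ioo] with η hη
      have h0 : 0 < η := hη.1
      have hp : 0 < η ^ (-n - 1) := Real.rpow_pos_of_pos h0 _
      simp only [Pi.add_apply]
      rw [norm_mul, norm_mul, Real.norm_eq_abs, Real.norm_eq_abs, Real.norm_eq_abs, abs_of_pos hp]
      have e1 : η ^ (-n) = η ^ (-n - 1) * η := by
        rw [← Real.rpow_add_one h0.ne']; congr 1; ring
      rw [e1]
      have := mul_le_mul_of_nonneg_left (hb η h0) hp.le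
      linarith
  · have t3 : Filter.Tendsto (fun η : ℝ => η ^ (-n)) (nhdsWithin 0 (Set.Ioi 0)) (nhds 0) := by
      have := (Real.continuousAt_rpow_const 0 (-n) (Or.inr (by linarith))).tendsto
      rw [Real.zero_rpow (by linarith)] at this
      exact this.mono_left nhdsWithin_le_nhds
    have t5 : Filter.Tendsto (fun η : ℝ => η) (nhdsWithin 0 (Set.Ioi 0)) (nhds 0) :=
      nhdsWithin_le_nhds
    have t4 := (h2.abs.add (t3.const_mul K)).add ((t3.mul t5).const_mul e)
    simp only [abs_zero, mul_zero, add_zero] at t4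
    refine squeeze_zero_norm' ?_ t4
    filter_upwards [self_mem_nhdsWithin] with η hη
    have h0 : 0 < η := hη
    have hp : 0 < η ^ (-n) := Real.rpow_pos_of_pos h0 _
    rw [norm_mul, abs_mul, Real.norm_eq_abs, Real.norm_eq_abs, abs_of_pos hp]
    have := mul_le_mul_of_nonneg_left (hb η h0) hp.le
    linarith

theorem aux_v0 (v I : ℝ → ℝ) (n e k y : ℝ) (hn : n < 0) (hy : 0 < y)
    (hv : MonotoneOn v (Set.Ioi 0))
    (hI : IntegrableOn (fun η => η ^ (-n) * I η) (Set.Ioo 0 y))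
    (hb : ∀ η : ℝ, 0 < η → |v η| ≤ e + k * I η) :
    IntegrableOn (fun η => η ^ (-n) * v η) (Set.Ioo 0 y) := by
  have hi := ((aux_pow0 (-n) y (by linarith) hy).const_mul e).add (hI.const_mul k)
  refine Integrable.mono' hi ?_ ?_
  · apply AEStronglyMeasurable.mul
    · exact ((aux_pow_cont (-n)).mono (fun x hx => hx.1)).aestronglyMeasurable
        measurableSet_Ioo
    · exact (aemeasurable_restrict_of_monotoneOn measurableSet_Ioo
        (hv.mono (fun x hx => hx.1))).aestronglyMeasurable
  · filter_upwards [ae_restrict_mem measurableSet_Ioo] with η hη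
    have h0 : 0 < η := hη.1
    have hp : 0 < η ^ (-n) := Real.rpow_pos_of_pos h0 _
    simp only [Pi.add_apply]
    rw [norm_mul, Real.norm_eq_abs, Real.norm_eq_abs, abs_of_pos hp]
    have := mul_le_mul_of_nonneg_left (hb η h0) hp.le
    linarith

theorem aux_ii (v : ℝ → ℝ) (n a b : ℝ) (ha : 0 < a) (hab : a ≤ b)
    (hv : MonotoneOn v (Set.Ioi 0)) :
    IntervalIntegrable (fun η => η ^ n * v η) volume a b := by
  have hsub : Set.Icc a b ⊆ Set.Ioi 0 := fun x hx => lt_of_lt_of_le ha hx.1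
  have : IntervalIntegrable v volume a b := by
    apply MonotoneOn.intervalIntegrable
    rw [Set.uIcc_of_le hab]; exact hv.mono hsub
  apply this.continuousOn_mul
  rw [Set.uIcc_of_le hab]; exact (aux_pow_cont n).mono hsub

theorem aux_lin (v : ℝ → ℝ) (n₁ n₂ a b c α β : ℝ) (ha : 0 < a) (hab : a ≤ b)
    (hn₁ : 1 < n₁) (hn₂ : n₂ < 0)
    (hv : MonotoneOn v (Set.Ioi 0)) :
    ∫ η in a..b, (α * η ^ (-n₁) + β * η ^ (-n₂)) * (v η + c) =
      α * (∫ η in a..b, η ^ (-n₁) * v η) + β * (∫ η in a..b, η ^ (-n₂) * v η) +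
      c * (α * ((b * b ^ (-n₁) - a * a ^ (-n₁)) / (1 - n₁)) +
        β * ((b * b ^ (-n₂) - a * a ^ (-n₂)) / (1 - n₂))) := by
  have hb : 0 < b := lt_of_lt_of_le ha hab
  have h0 : (0:ℝ) ∉ Set.uIcc a b := by
    rw [Set.uIcc_of_le hab]; intro h; exact absurd h.1 (not_le.2 ha)
  have e : ∀ (m : ℝ), m ≠ 1 → ∫ η in a..b, η ^ (-m) = (b * b ^ (-m) - a * a ^ (-m)) / (1 - m) := by
    intro m hm
    rw [integral_rpow (Or.inr ⟨fun h => hm (by linarith), h0⟩), Real.rpow_add_one hb.ne',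
      Real.rpow_add_one ha.ne', mul_comm, mul_comm (a ^ (-m)), show -m + 1 = 1 - m by ring]
  have p : ∀ m : ℝ, IntervalIntegrable (fun η : ℝ => η ^ m) volume a b := fun m =>
    intervalIntegral.intervalIntegrable_rpow (Or.inr h0)
  have q : ∀ m : ℝ, IntervalIntegrable (fun η : ℝ => η ^ m * v η) volume a b := fun m =>
    aux_ii v m a b ha hab hv
  rw [← e n₁ hn₁.ne', ← e n₂ (by linarith)]
  have r : ∀ η, (α * η ^ (-n₁) + β * η ^ (-n₂)) * (v η + c) =
     (α * (η ^ (-n₁) * v η) + β * (η ^ (-n₂) * v η)) +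
       (c * α * η ^ (-n₁) + c * β * η ^ (-n₂)) := fun η => by ring
  simp_rw [r]
  rw [intervalIntegral.integral_add (((q _).const_mul _).add ((q _).const_mul _))
      (((p _).const_mul _).add ((p _).const_mul _)),
    intervalIntegral.integral_add ((q _).const_mul _) ((q _).const_mul _),
    intervalIntegral.integral_add ((p _).const_mul _) ((p _).const_mul _)]
  simp only [intervalIntegral.integral_const_mul]
  ring

theorem aux_D (v : ℝ → ℝ) (n₁ n₂ s z b : ℝ) (hs : 0 < s) (hsz : s < z) (hzb : z < b)
    (hn₁ : 1 < n₁) (hn₂ : n₂ < 0)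
    (hv : MonotoneOn v (Set.Ioi 0))
    (hD : 0 < (n₁ - 1) * (s ^ n₁ * ∫ η in s..b, η ^ (-n₁) * v η) +
      (1 - n₂) * (s ^ n₂ * ∫ η in s..b, η ^ (-n₂) * v η)) :
    0 < (n₁ - 1) * (z ^ n₁ * ∫ η in z..b, η ^ (-n₁) * v η) +
      (1 - n₂) * (z ^ n₂ * ∫ η in z..b, η ^ (-n₂) * v η) := by
  have hz : 0 < z := hs.trans hsz
  have hb : 0 < b := hz.trans hzb
  have ha1 : 0 < n₁ - 1 := by linarith
  have ha2 : 0 < 1 - n₂ := by linarith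
  have hP : ∀ x m : ℝ, 0 < x → 0 < x ^ m := fun x m hx => Real.rpow_pos_of_pos hx m
  by_cases hvz : 0 < v z
  · have g : ∀ m : ℝ, 0 < ∫ η in z..b, η ^ m * v η := by
      intro m
      apply intervalIntegral.intervalIntegral_pos_of_pos_on (aux_ii v m z b hz hzb.le hv) _ hzb
      intro x hx
      have hx0 : 0 < x := hz.trans hx.1
      exact mul_pos (hP _ _ hx0) (lt_of_lt_of_le hvz (hv hz hx0 hx.1.le))
    have := g (-n₁)
    have := g (-n₂)
    have := hP z n₁ hz
    have := hP z n₂ hz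
    positivity
  · push Not at hvz
    have q : ∀ m : ℝ, ∀ x y, 0 < x → x ≤ y →
      IntervalIntegrable (fun η : ℝ => η ^ m * v η) volume x y := fun m x y hx hxy =>
      aux_ii v m x y hx hxy hv
    have add1 := intervalIntegral.integral_add_adjacent_intervals (q (-n₁) s z hs hsz.le)
      (q (-n₁) z b hz hzb.le)
    have add2 := intervalIntegral.integral_add_adjacent_intervals (q (-n₂) s z hs hsz.le)
      (q (-n₂) z b hz hzb.le)
    rw [← add1, ← add2] at hD
    have r : ∀ x m : ℝ, 0 < x → x ^ m * x ^ (-m) = 1 := fun x m hx => by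
      rw [← Real.rpow_add hx]; simp
    have rs1 := r s n₁ hs
    have rs2 := r s n₂ hs
    have rz1 := r z n₁ hz
    have rz2 := r z n₂ hz
    have ps1 := hP s n₁ hs
    have ps2 := hP s n₂ hs
    have pz1 := hP z n₁ hz
    have pz2 := hP z n₂ hz
    have pb1 := hP b (-n₁) hb
    have pb2 := hP b (-n₂) hb
    have m1 : s ^ n₁ ≤ z ^ n₁ := Real.rpow_le_rpow hs.le hsz.le (by linarith)
    have m2 : z ^ n₂ ≤ s ^ n₂ := Real.rpow_le_rpow_of_nonpos hs hsz.le hn₂.le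
    have m3 : s ^ n₁ * z ^ n₂ ≤ z ^ n₁ * s ^ n₂ := mul_le_mul m1 m2 pz2.le pz1.le
    set ws := (n₁ - 1) * s ^ n₁ * b ^ (-n₁) + (1 - n₂) * s ^ n₂ * b ^ (-n₂) with hws
    set wz := (n₁ - 1) * z ^ n₁ * b ^ (-n₁) + (1 - n₂) * z ^ n₂ * b ^ (-n₂) with hwz
    have hwsp : 0 < ws := by positivity
    have hwzp : 0 < wz := by positivity
    have L1 := aux_lin v n₁ n₂ z b (- v z) ((n₁ - 1) * (ws * z ^ n₁ - wz * s ^ n₁))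
      ((1 - n₂) * (ws * z ^ n₂ - wz * s ^ n₂)) hz hzb.le hn₁ hn₂ hv
    have L2 := aux_lin v n₁ n₂ s z (- v z) ((n₁ - 1) * s ^ n₁)
      ((1 - n₂) * s ^ n₂) hs hsz.le hn₁ hn₂ hv
    have S1 : 0 ≤ ∫ η in z..b, ((n₁ - 1) * (ws * z ^ n₁ - wz * s ^ n₁) * η ^ (-n₁) +
        (1 - n₂) * (ws * z ^ n₂ - wz * s ^ n₂) * η ^ (-n₂)) * (v η + - v z) := by
      apply intervalIntegral.integral_nonneg hzb.le
      intro x hx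
      have hx0 : 0 < x := lt_of_lt_of_le hz hx.1
      apply mul_nonneg
      · have px1 := hP x (-n₁) hx0
        have px2 := hP x (-n₂) hx0
        have k1 : b ^ (-n₁) ≤ x ^ (-n₁) :=
          Real.rpow_le_rpow_of_nonpos hx0 hx.2 (by linarith)
        have k2 : x ^ (-n₂) ≤ b ^ (-n₂) := Real.rpow_le_rpow hx0.le hx.2 (by linarith)
        have k3 : x ^ (-n₂) * b ^ (-n₁) ≤ x ^ (-n₁) * b ^ (-n₂) := by
          rw [mul_comm]; exact mul_le_mul k1 k2 px2.le px1.le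
        have : (n₁ - 1) * (ws * z ^ n₁ - wz * s ^ n₁) * x ^ (-n₁) +
            (1 - n₂) * (ws * z ^ n₂ - wz * s ^ n₂) * x ^ (-n₂) =
            (n₁ - 1) * (1 - n₂) * ((z ^ n₁ * s ^ n₂ - s ^ n₁ * z ^ n₂) *
            (x ^ (-n₁) * b ^ (-n₂) - x ^ (-n₂) * b ^ (-n₁))) := by
          rw [hws, hwz]; ring
        rw [this]
        exact mul_nonneg (by positivity) (mul_nonneg (by linarith) (by linarith))
      · linarith [hv hz hx0 hx.1]
    have S2 : ∫ η in s..z, ((n₁ - 1) * s ^ n₁ * η ^ (-n₁) +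
        (1 - n₂) * s ^ n₂ * η ^ (-n₂)) * (v η + - v z) ≤ 0 := by
      have : 0 ≤ ∫ η in s..z, -(((n₁ - 1) * s ^ n₁ * η ^ (-n₁) +
        (1 - n₂) * s ^ n₂ * η ^ (-n₂)) * (v η + - v z)) := by
        apply intervalIntegral.integral_nonneg hsz.le
        intro x hx
        have hx0 : 0 < x := lt_of_lt_of_le hs hx.1
        have px1 := hP x (-n₁) hx0
        have px2 := hP x (-n₂) hx0
        rw [← mul_neg]
        apply mul_nonneg (by positivity)
        linarith [hv hx0 hz hx.2]
      rw [intervalIntegral.integral_neg] at this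
      linarith
    rw [L1] at S1
    rw [L2] at S2
    clear L1 L2
    generalize (∫ η in z..b, η ^ (-n₁) * v η) = X at *
    generalize (∫ η in z..b, η ^ (-n₂) * v η) = Y at *
    generalize (∫ η in s..z, η ^ (-n₁) * v η) = A at *
    generalize (∫ η in s..z, η ^ (-n₂) * v η) = B at *
    have hcpos : 0 ≤ - v z := by linarith
    generalize - v z = c at *
    -- combine
    have S3 := mul_nonpos_of_nonneg_of_nonpos hwzp.le S2
    have S4 := mul_pos hwzp hD
    -- constants
    have T1 : (n₁ - 1) * (ws * z ^ n₁ - wz * s ^ n₁) *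
          ((b * b ^ (-n₁) - z * z ^ (-n₁)) / (1 - n₁)) +
        (1 - n₂) * (ws * z ^ n₂ - wz * s ^ n₂) * ((b * b ^ (-n₂) - z * z ^ (-n₂)) / (1 - n₂)) =
        - (ws * z ^ n₁ - wz * s ^ n₁) * (b * b ^ (-n₁) - z * z ^ (-n₁)) +
        (ws * z ^ n₂ - wz * s ^ n₂) * (b * b ^ (-n₂) - z * z ^ (-n₂)) := by
      have : 1 - n₁ ≠ 0 := by linarith
      have : 1 - n₂ ≠ 0 := by linarith
      field_simp
      ring
    have T2 : (n₁ - 1) * s ^ n₁ * ((z * z ^ (-n₁) - s * s ^ (-n₁)) / (1 - n₁)) +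
        (1 - n₂) * s ^ n₂ * ((z * z ^ (-n₂) - s * s ^ (-n₂)) / (1 - n₂)) =
        - s ^ n₁ * (z * z ^ (-n₁) - s * s ^ (-n₁)) +
        s ^ n₂ * (z * z ^ (-n₂) - s * s ^ (-n₂)) := by
      have : 1 - n₁ ≠ 0 := by linarith
      have : 1 - n₂ ≠ 0 := by linarith
      field_simp
      ring
    rw [T1] at S1
    rw [T2] at S3
    have T3 : (- (ws * z ^ n₁ - wz * s ^ n₁) * (b * b ^ (-n₁) - z * z ^ (-n₁)) +
        (ws * z ^ n₂ - wz * s ^ n₂) * (b * b ^ (-n₂) - z * z ^ (-n₂))) -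
        wz * (- s ^ n₁ * (z * z ^ (-n₁) - s * s ^ (-n₁)) +
        s ^ n₂ * (z * z ^ (-n₂) - s * s ^ (-n₂))) =
        b * ((n₁ - 1) + (1 - n₂)) * b ^ (-n₁) * b ^ (-n₂) *
          (s ^ n₁ * z ^ n₂ - z ^ n₁ * s ^ n₂) := by
      linear_combination (exp := 1) ws * z * rz1 - wz * s * rs1 - ws * z * rz2 + wz * s * rs2 +
        b * (z ^ n₂ * b ^ (-n₂) - z ^ n₁ * b ^ (-n₁)) * hws -
        b * (s ^ n₂ * b ^ (-n₂) - s ^ n₁ * b ^ (-n₁)) * hwz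
    have T4 : b * ((n₁ - 1) + (1 - n₂)) * b ^ (-n₁) * b ^ (-n₂) *
          (s ^ n₁ * z ^ n₂ - z ^ n₁ * s ^ n₂) ≤ 0 :=
      mul_nonpos_of_nonneg_of_nonpos (by positivity) (by linarith)
    have T5 := mul_nonpos_of_nonneg_of_nonpos hcpos T4
    rw [← T3] at T5
    have fin : 0 < ws * ((n₁ - 1) * (z ^ n₁ * X) + (1 - n₂) * (z ^ n₂ * Y)) := by
      linarith
    exact (pos_iff_pos_of_mul_pos fin).1 hwsp

theorem aux_I0 (I : ℝ → ℝ) (n y : ℝ) (hn : n < 0) (hy : 0 < y)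
    (hIa : StrictAntiOn I (Set.Ioi 0))
    (hI : IntegrableOn (fun η => η ^ (-n) * I η) (Set.Ioo 0 y)) :
    y * I y < (1 - n) * (y ^ n * ∫ η in Set.Ioo 0 y, η ^ (-n) * I η) := by
  have hp := aux_pow0 (-n) y (by linarith) hy
  have hd : IntegrableOn (fun η => η ^ (-n) * I η - η ^ (-n) * I y) (Set.Ioo 0 y) :=
    hI.sub (hp.mul_const _)
  have hy2 : 0 < y / 2 := by linarith
  have h1 := aux_split0 _ (y/2) y hy2 (by linarith) hd
  have h2 : 0 ≤ ∫ η in Set.Ioo 0 (y/2), (η ^ (-n) * I η - η ^ (-n) * I y) := by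
    apply setIntegral_nonneg measurableSet_Ioo
    intro x hx
    have := hIa (Set.mem_Ioi.2 hx.1) (Set.mem_Ioi.2 hy) (by linarith [hx.2])
    have := mul_le_mul_of_nonneg_left this.le (Real.rpow_nonneg hx.1.le (-n))
    linarith
  have h3 : 0 < ∫ η in (y/2)..y, (η ^ (-n) * I η - η ^ (-n) * I y) := by
    apply intervalIntegral.intervalIntegral_pos_of_pos_on _ _ (by linarith)
    · rw [intervalIntegrable_iff_integrableOn_Ioo_of_le (by linarith)]
      exact hd.mono_set (Set.Ioo_subset_Ioo hy2.le le_rfl)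
    · intro x hx
      have hx0 : 0 < x := by linarith [hx.1]
      have := hIa (Set.mem_Ioi.2 hx0) (Set.mem_Ioi.2 hy) (by linarith [hx.2])
      have := mul_lt_mul_of_pos_left this (Real.rpow_pos_of_pos hx0 (-n))
      linarith
  have h4 : ∫ η in Set.Ioo 0 y, (η ^ (-n) * I η - η ^ (-n) * I y) =
      (∫ η in Set.Ioo 0 y, η ^ (-n) * I η) - y * y ^ (-n) / (1 - n) * I y := by
    rw [integral_sub hI (hp.mul_const _), integral_mul_const, ← integral_Ioc_eq_integral_Ioo
      (f := fun η : ℝ => η ^ (-n)),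
      ← intervalIntegral.integral_of_le hy.le, integral_rpow (Or.inl (by linarith)),
      Real.zero_rpow (by linarith), sub_zero, Real.rpow_add_one hy.ne',
      show -n + 1 = 1 - n by ring, mul_comm y]
  have r : y ^ n * y ^ (-n) = 1 := by rw [← Real.rpow_add hy]; simp
  have pn := Real.rpow_pos_of_pos hy n
  have h5 : y * y ^ (-n) / (1 - n) * I y < ∫ η in Set.Ioo 0 y, η ^ (-n) * I η := by linarith
  have hn1 : 0 < 1 - n := by linarith
  have h6 := mul_lt_mul_of_pos_left h5 (mul_pos hn1 pn)
  have h7 : (1 - n) * y ^ n * (y * y ^ (-n) / (1 - n) * I y) = y * I y := by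
    field_simp
    linear_combination I y * r
  linarith

theorem aux_Iinf (I : ℝ → ℝ) (n y : ℝ) (hn : 1 < n) (hy : 0 < y)
    (hIa : StrictAntiOn I (Set.Ioi 0))
    (hI : IntegrableOn (fun η => η ^ (-n) * I η) (Set.Ioi y)) :
    (n - 1) * (y ^ n * ∫ η in Set.Ioi y, η ^ (-n) * I η) ≤ y * I y := by
  have hp := integrableOn_Ioi_rpow_of_lt (a := -n) (by linarith) hy
  have h5 : ∫ η in Set.Ioi y, η ^ (-n) * I η ≤ ∫ η in Set.Ioi y, η ^ (-n) * I y := by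
    apply setIntegral_mono_on hI (hp.mul_const _) measurableSet_Ioi
    intro x hx
    have hx0 : 0 < x := lt_trans hy hx
    exact mul_le_mul_of_nonneg_left (hIa (Set.mem_Ioi.2 hy) (Set.mem_Ioi.2 hx0) hx).le
      (Real.rpow_nonneg hx0.le _)
  rw [integral_mul_const, integral_Ioi_rpow_of_lt (by linarith) hy, Real.rpow_add_one hy.ne'] at h5
  have r : y ^ n * y ^ (-n) = 1 := by rw [← Real.rpow_add hy]; simp
  have pn := Real.rpow_pos_of_pos hy n
  have hn1 : 0 < n - 1 := by linarith
  have h6 := mul_le_mul_of_nonneg_left h5 (mul_pos hn1 pn).le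
  have h7 : (n - 1) * y ^ n * (-(y ^ (-n) * y) / (-n + 1) * I y) = y * I y := by
    have : -n + 1 ≠ 0 := by linarith
    field_simp
    linear_combination I y * (1 - n) * r
  linarith

theorem aux_ivt (Q d : ℝ → ℝ) (b : ℝ) (hb : 0 < b) (hm : StrictMonoOn d (Set.Ioo 0 b))
    (hc : ∀ y ∈ Set.Ioo 0 b, HasDerivAt Q (d y) y)
    (h0 : Filter.Tendsto d (nhdsWithin 0 (Set.Ioi 0)) Filter.atBot)
    (h1 : Filter.Tendsto d (nhdsWithin b (Set.Iio b)) (nhds 0)) (x : ℝ) (hx : 0 < x) :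
    ∃! y : ℝ, y ∈ Set.Ioo 0 b ∧ x = - deriv Q y := by
  obtain ⟨p, hp, hp'⟩ := ((h0.eventually_lt_atBot (-x)).and (Ioo_mem_nhdsGT hb)).exists
  obtain ⟨q, hq, hq'⟩ := ((h1.eventually_const_lt (show -x < 0 by linarith)).and
    (Ioo_mem_nhdsLT hb)).exists
  have hpq : p < q := (hm.lt_iff_lt hp' hq').1 (hp.trans hq)
  obtain ⟨y, hy, hy'⟩ := exists_hasDerivWithinAt_eq_of_gt_of_lt hpq.le
    (fun w hw => (hc w (Set.Icc_subset_Ioo hp'.1 hq'.2 hw)).hasDerivWithinAt) hp hq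
  have hyb : y ∈ Set.Ioo 0 b := ⟨hp'.1.trans hy.1, hy.2.trans hq'.2⟩
  refine ⟨y, ⟨hyb, by rw [(hc y hyb).deriv, hy']; ring⟩, ?_⟩
  rintro w ⟨hw, hw'⟩
  rw [(hc w hw).deriv] at hw'
  exact hm.injOn hw hyb (by linarith)

theorem aux_S_s19 (V : ℝ → ℝ) (n₁ n₂ c₁ c₂ : ℝ) (hVc : ContinuousOn V (Set.Ioi 0))
    (i1 : ∀ y : ℝ, 0 < y → IntegrableOn (fun η => η ^ (-n₁ - 1) * V η) (Set.Ioi y))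
    (i2 : ∀ y : ℝ, 0 < y → IntegrableOn (fun η => η ^ (-n₂ - 1) * V η) (Set.Ioo 0 y))
    (z : ℝ) (hz : 0 < z) :
    HasDerivAt (fun z => z ^ n₂ * ((∫ η in Set.Ioo 0 z, η ^ (-n₂ - 1) * V η) - c₂) +
      z ^ n₁ * ((∫ η in Set.Ioi z, η ^ (-n₁ - 1) * V η) - c₁))
     ((z ^ n₂ * (n₂ * ((∫ η in Set.Ioo 0 z, η ^ (-n₂ - 1) * V η) - c₂)) +
      z ^ n₁ * (n₁ * ((∫ η in Set.Ioi z, η ^ (-n₁ - 1) * V η) - c₁))) / z) z ∧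
    HasDerivAt (fun z => (z ^ n₂ * (n₂ * ((∫ η in Set.Ioo 0 z, η ^ (-n₂ - 1) * V η) - c₂)) +
      z ^ n₁ * (n₁ * ((∫ η in Set.Ioi z, η ^ (-n₁ - 1) * V η) - c₁))) / z)
     (((n₂ - 1) * (z ^ n₂ * (n₂ * ((∫ η in Set.Ioo 0 z, η ^ (-n₂ - 1) * V η) - c₂))) +
      (n₁ - 1) * (z ^ n₁ * (n₁ * ((∫ η in Set.Ioi z, η ^ (-n₁ - 1) * V η) - c₁))) +
      (n₂ - n₁) * V z) / z ^ 2) z := by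
  have d1 := (aux_dIoi _ ((aux_pow_cont (-n₁ - 1)).mul hVc) i1 z hz).sub_const c₁
  have d2 := (aux_dIoo _ ((aux_pow_cont (-n₂ - 1)).mul hVc) i2 z hz).sub_const c₂
  have p : ∀ n : ℝ, HasDerivAt (fun z : ℝ => z ^ n) (n * (z ^ n / z)) z := fun n => by
    have := Real.hasDerivAt_rpow_const (x := z) (p := n) (Or.inl hz.ne')
    rwa [Real.rpow_sub_one hz.ne'] at this
  have r : ∀ n : ℝ, z ^ n * z ^ (-n - 1) = 1 / z := fun n => by
    rw [← Real.rpow_add hz, show n + (-n - 1) = -1 by ring, Real.rpow_neg_one, one_div]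
  have r1 := r n₁
  have r2 := r n₂
  constructor
  · refine (((p n₂).mul d2).add ((p n₁).mul d1)).congr_deriv ?_
    simp only [Pi.mul_apply]
    linear_combination V z * r2 - V z * r1
  · refine ((((p n₂).mul (d2.const_mul n₂)).add ((p n₁).mul (d1.const_mul n₁))).div
      (hasDerivAt_id z) hz.ne').congr_deriv ?_
    simp only [Pi.mul_apply, Pi.add_apply, id]
    have hz2 := hz.ne'
    rw [div_left_inj' (by positivity)]
    generalize (∫ η in Set.Ioo 0 z, η ^ (-n₂ - 1) * V η) - c₂ = A
    generalize (∫ η in Set.Ioi z, η ^ (-n₁ - 1) * V η) - c₁ = B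
    have r1' : z * (z ^ n₁ * z ^ (-n₁ - 1)) = 1 := by rw [r1]; field_simp
    have r2' : z * (z ^ n₂ * z ^ (-n₂ - 1)) = 1 := by rw [r2]; field_simp
    have q1 : z ^ n₁ / z * z = z ^ n₁ := by field_simp
    have q2 : z ^ n₂ / z * z = z ^ n₂ := by field_simp
    linear_combination n₂ * V z * r2' - n₁ * V z * r1' + n₁ * n₁ * B * q1 + n₂ * n₂ * A * q2

set_option maxHeartbeats 4000000 in
/-- for every x > 0 there exists a unique y* ∈ (0, z_B) with x = −Q′(y*). -/
theorem stmt_19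
    (δ r θ n₁ n₂ : ℝ)
    (hδ : 0 < δ) (hr : 0 < r) (hθ : θ ≠ 0)
    (hn₂0 : n₂ < 0) (hn₁1 : 1 < n₁)
    (hroot₁ : θ ^ 2 / 2 * n₁ ^ 2 + (δ - r - θ ^ 2 / 2) * n₁ - δ = 0)
    (hroot₂ : θ ^ 2 / 2 * n₂ ^ 2 + (δ - r - θ ^ 2 / 2) * n₂ - δ = 0)
    (u u' I utld : ℝ → ℝ)
    (hu_mono : StrictMonoOn u (Set.Ici 0))
    (hu_conc : StrictConcaveOn ℝ (Set.Ici 0) u)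
    (hu_cont : ContinuousOn u (Set.Ici 0))
    (hu_deriv : ∀ c : ℝ, 0 < c → HasDerivAt u (u' c) c)
    (hu'_cont : ContinuousOn u' (Set.Ioi 0))
    (hu'_top : Filter.Tendsto u' Filter.atTop (nhds 0))
    (hu'_zero : Filter.Tendsto u' (nhdsWithin 0 (Set.Ioi 0)) Filter.atTop)
    (hI_pos : ∀ y : ℝ, 0 < y → 0 < I y)
    (hI_left : ∀ y : ℝ, 0 < y → u' (I y) = y)
    (hI_right : ∀ c : ℝ, 0 < c → I (u' c) = c)
    (hI_anti : StrictAntiOn I (Set.Ioi 0))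
    (hI_cont : ContinuousOn I (Set.Ioi 0))
    (hI_zero : Filter.Tendsto I (nhdsWithin 0 (Set.Ioi 0)) Filter.atTop)
    (hI_top : Filter.Tendsto I Filter.atTop (nhds 0))
    (hutld : ∀ y : ℝ, 0 < y → utld y = u (I y) - y * I y)
    (ε₁ ε₂ κ₁ κ₂ : ℝ)
    (hε₂ : 0 < ε₂) (hε₁₂ : ε₂ < ε₁)
    (hκ₁ : 0 < κ₁) (hκ₁₂ : κ₁ < κ₂) (hκ₂ : κ₂ < 1)
    (z_S : ℝ) (hzS_pos : 0 < z_S)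
    (hzS_zero : (1 / z_S) * (utld (z_S / κ₁) - utld (z_S / κ₂) + z_S * (ε₁ - ε₂)) = 0)
    (hzS_uniq : ∀ y : ℝ, 0 < y →
      (1 / y) * (utld (y / κ₁) - utld (y / κ₂) + y * (ε₁ - ε₂)) = 0 → y = z_S)
    (h : ℝ → ℝ)
    (hh₁ : ∀ z : ℝ, z_S < z → h z = utld (z / κ₁) - utld z + ε₁ * z)
    (hh₂ : ∀ z : ℝ, 0 < z → z ≤ z_S → h z = utld (z / κ₂) - utld z + ε₂ * z)
    (zhat : ℝ) (hzhat_pos : 0 < zhat) (hzhat_zero : h zhat = 0)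
    (hzhat_uniq : ∀ z : ℝ, 0 < z → h z = 0 → z = zhat)
    (hI_int : ∀ y : ℝ, 0 < y →
      MeasureTheory.IntegrableOn (fun η => η ^ (-n₂) * I η) (Set.Ioo 0 y) MeasureTheory.volume)
    (chat ehat : ℝ → ℝ)
    (hchat₁ : ∀ η : ℝ, z_S < η → chat η = (1 / κ₁) * I (η / κ₁))
    (hchat₂ : ∀ η : ℝ, 0 < η → η ≤ z_S → chat η = (1 / κ₂) * I (η / κ₂))
    (hehat₁ : ∀ η : ℝ, z_S < η → ehat η = ε₁)
    (hehat₂ : ∀ η : ℝ, 0 < η → η ≤ z_S → ehat η = ε₂)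
    (φ₁ φ₂ : ℝ → ℝ → ℝ)
    (hφ₁ : ∀ z₁ z₂ : ℝ, 0 < z₁ → 0 < z₂ →
      φ₁ z₁ z₂ = (∫ η in Set.Ioi z₂, η ^ (-n₁) * (ehat η - chat η)) -
        n₁ * ∫ η in Set.Ioi z₁, η ^ (-n₁ - 1) * h η)
    (hφ₂ : ∀ z₁ z₂ : ℝ, 0 < z₁ → 0 < z₂ →
      φ₂ z₁ z₂ = (∫ η in Set.Ioo 0 z₂, η ^ (-n₂) * (ehat η - chat η)) -
        n₂ * ∫ η in Set.Ioo 0 z₁, η ^ (-n₂ - 1) * h η)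
    (J_R : ℝ → ℝ)
    (hJR : ∀ y : ℝ, 0 < y → J_R y = (2 / (θ ^ 2 * (n₁ - n₂))) *
      (y ^ n₂ * (∫ η in Set.Ioo 0 y, η ^ (-n₂ - 1) * utld η) +
       y ^ n₁ * ∫ η in Set.Ioi y, η ^ (-n₁ - 1) * utld η))
    (z_R z_B : ℝ) (hzR_pos : 0 < z_R) (hzR_lt : z_R < zhat) (hzRB : z_R < z_B)
    (hφ₁RB : φ₁ z_R z_B = 0) (hφ₂RB : φ₂ z_R z_B = 0)
    (E₁ E₂ : ℝ)
    (hE₁ : E₁ = -(2 / (θ ^ 2 * (n₁ - n₂))) * ∫ η in Set.Ioi z_R, η ^ (-n₁ - 1) * h η)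
    (hE₂ : E₂ = -(2 / (θ ^ 2 * (n₁ - n₂))) * ∫ η in Set.Ioo 0 z_R, η ^ (-n₂ - 1) * h η)
    (Ψ : ℝ → ℝ)
    (hΨ : ∀ z : ℝ, 0 < z → Ψ z = (2 / (θ ^ 2 * (n₁ - n₂))) *
      (z ^ n₂ * (∫ η in Set.Ioo 0 z, η ^ (-n₂ - 1) * h η) +
       z ^ n₁ * ∫ η in Set.Ioi z, η ^ (-n₁ - 1) * h η))
    (Q : ℝ → ℝ)
    (hQ₁ : ∀ z : ℝ, 0 < z → z ≤ z_R → Q z = J_R z)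
    (hQ₂ : ∀ z : ℝ, z_R ≤ z → z ≤ z_B → Q z = E₁ * z ^ n₁ + E₂ * z ^ n₂ + Ψ z + J_R z)
    (hQ₃ : ∀ z : ℝ, z_B ≤ z → Q z = E₁ * z_B ^ n₁ + E₂ * z_B ^ n₂ + Ψ z_B + J_R z_B)
    :
    ∀ x : ℝ, 0 < x → ∃! y : ℝ, y ∈ Set.Ioo 0 z_B ∧ x = -deriv Q y := by
  have hM : ∀ a c : ℝ, 0 < a → 0 ≤ c → u c - a * c ≤ utld a := fun a c ha hc =>
    aux_max u u' I utld hu_conc hu_deriv hI_pos hI_left hutld a c ha hc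
  have hT : ∀ a b : ℝ, 0 < a → 0 < b → utld b + (b - a) * I b ≤ utld a := by
    intro a b ha hb
    have := hM a (I b) ha (hI_pos b hb).le
    rw [hutld b hb]; linarith
  have hud : ∀ a : ℝ, 0 < a → HasDerivAt utld (- I a) a := fun a ha =>
    aux_deriv I utld hI_cont hT a ha
  have huc : ContinuousOn utld (Set.Ioi 0) := fun x hx =>
    (hud x hx).continuousAt.continuousWithinAt
  have hum : ∀ a : ℝ, 0 < a → u 0 ≤ utld a := fun a ha => by
    have := hM a 0 ha le_rfl; linarith
  have hua : AntitoneOn utld (Set.Ioi 0) := by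
    intro a ha b hb hab
    have := hT a b ha hb
    have := mul_nonneg (sub_nonneg.2 hab) (hI_pos b hb).le
    linarith
  obtain ⟨j2, jl2⟩ := aux_base0 utld I n₂ (u 0) hn₂0 hud hum hua hI_anti.antitoneOn hI_pos hI_int
  have habs : ∀ y η : ℝ, 0 < y → y ≤ η → |utld η| ≤ |utld y| + |u 0| := by
    intro y η hy hη
    have h1 := hua hy (lt_of_lt_of_le hy hη) hη
    have h2 := hum η (lt_of_lt_of_le hy hη)
    rw [abs_le]
    constructor
    · linarith [neg_abs_le (u 0), abs_nonneg (utld y)]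
    · linarith [le_abs_self (utld y), abs_nonneg (u 0)]
  have j1 : ∀ y : ℝ, 0 < y → IntegrableOn (fun η => η ^ (-n₁ - 1) * utld η) (Set.Ioi y) :=
    fun y hy => (aux_growth utld n₁ 0 y (|utld y| + |u 0|) hn₁1 hy huc (fun η hη => by
      have := habs y η hy hη; linarith)).1
  have jl1 := (aux_growth utld n₁ 0 1 (|utld 1| + |u 0|) hn₁1 one_pos huc (fun η hη => by
      have := habs 1 η one_pos hη; linarith)).2
  have hnI : MonotoneOn (fun x => - I x) (Set.Ioi 0) := fun x hx y hy hxy =>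
    neg_le_neg (hI_anti.antitoneOn hx hy hxy)
  have hIabs : ∀ y η : ℝ, 0 < y → y ≤ η → |I η| ≤ I y := fun y η hy hη => by
    rw [abs_of_pos (hI_pos _ (lt_of_lt_of_le hy hη))]
    exact hI_anti.antitoneOn hy (lt_of_lt_of_le hy hη) hη
  have hI1' : ∀ y : ℝ, 0 < y → IntegrableOn (fun η => η ^ (-n₁) * (- I η)) (Set.Ioi y) :=
    fun y hy => aux_vinf (fun x => - I x) n₁ y (I y) hn₁1 hy hnI (fun η hη => by
      rw [abs_neg]; exact hIabs y η hy hη)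
  have hI1 : ∀ y : ℝ, 0 < y → IntegrableOn (fun η => η ^ (-n₁) * (I η)) (Set.Ioi y) :=
    fun y hy => by
      have := (hI1' y hy).neg
      refine this.congr_fun (fun x _ => ?_) measurableSet_Ioi
      simp
  have hI2' : ∀ y : ℝ, 0 < y → IntegrableOn (fun η => η ^ (-n₂) * (- I η)) (Set.Ioo 0 y) :=
    fun y hy => by
      refine (hI_int y hy).neg.congr_fun (fun x _ => ?_) measurableSet_Ioo
      simp
  -- integration by parts for utld
  have B1 : ∀ y : ℝ, 0 < y → n₁ * (∫ η in Set.Ioi y, η ^ (-n₁ - 1) * utld η) =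
      y ^ (-n₁) * utld y - ∫ η in Set.Ioi y, η ^ (-n₁) * I η := fun y hy => by
    have := aux_bpinf utld (fun x => - I x) 0 n₁ y hy huc (fun η hη _ => hud η hη) hnI
      (hI1' y hy) (j1 y hy) jl1
    simp only [mul_neg, integral_neg] at this
    linarith
  have B2 : ∀ y : ℝ, 0 < y → n₂ * (∫ η in Set.Ioo 0 y, η ^ (-n₂ - 1) * utld η) =
      - (y ^ (-n₂) * utld y) - ∫ η in Set.Ioo 0 y, η ^ (-n₂) * I η := fun y hy => by
    have := aux_bp0 utld (fun x => - I x) 0 n₂ y hy huc (fun η hη _ => hud η hη) hnI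
      (hI2' y hy) (j2 y hy) jl2
    simp only [mul_neg, integral_neg] at this
    linarith
  have hκ₂p : 0 < κ₂ := hκ₁.trans hκ₁₂
  have hε₁ : 0 < ε₁ := hε₂.trans hε₁₂
  have hlt1 : ∀ κ z : ℝ, 0 < κ → κ < 1 → 0 < z → z < z / κ := fun κ z h1 h2 h3 => by
    rw [lt_div_iff₀ h1]; nlinarith
  have hlt2 : ∀ z : ℝ, 0 < z → z / κ₂ < z / κ₁ := fun z h3 =>
    div_lt_div_of_pos_left h3 hκ₁ hκ₁₂
  -- the function U
  set U : ℝ → ℝ := fun η => h η + utld η with hU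
  set v : ℝ → ℝ := fun η => ehat η - chat η with hvdef
  have U1 : ∀ z, z_S < z → U z = utld (z / κ₁) + ε₁ * z := fun z hz => by
    simp only [hU]; rw [hh₁ z hz]; ring
  have U2 : ∀ z, 0 < z → z ≤ z_S → U z = utld (z / κ₂) + ε₂ * z := fun z hz hz' => by
    simp only [hU]; rw [hh₂ z hz hz']; ring
  have v1 : ∀ z, z_S < z → v z = ε₁ - (1 / κ₁) * I (z / κ₁) := fun z hz => by
    simp only [hvdef]; rw [hehat₁ z hz, hchat₁ z hz]
  have v2 : ∀ z, 0 < z → z ≤ z_S → v z = ε₂ - (1 / κ₂) * I (z / κ₂) := fun z hz hz' => by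
    simp only [hvdef]; rw [hehat₂ z hz hz', hchat₂ z hz hz']
  have hSS : utld (z_S / κ₁) - utld (z_S / κ₂) + z_S * (ε₁ - ε₂) = 0 := by
    rcases mul_eq_zero.1 hzS_zero with h1 | h1
    · exact absurd h1 (by positivity)
    · exact h1
  have Ad : ∀ κ ε z : ℝ, 0 < κ → 0 < z →
      HasDerivAt (fun z => utld (z / κ) + ε * z) (ε - (1 / κ) * I (z / κ)) z := by
    intro κ ε z hκ hz
    have h1 := (hud (z / κ) (by positivity)).comp z ((hasDerivAt_id z).div_const κ)
    have h2 := h1.add ((hasDerivAt_id z).const_mul ε)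
    exact h2.congr_deriv (by ring)
  have hUd : ∀ η : ℝ, 0 < η → η ≠ z_S → HasDerivAt U (v η) η := by
    intro η hη hne
    rcases lt_or_gt_of_ne hne with hl | hl
    · rw [v2 η hη hl.le]
      refine (Ad κ₂ ε₂ η hκ₂p hη).congr_of_eventuallyEq ?_
      filter_upwards [Ioo_mem_nhds hη hl] with x hx
      exact U2 x hx.1 hx.2.le
    · rw [v1 η hl]
      refine (Ad κ₁ ε₁ η hκ₁ hη).congr_of_eventuallyEq ?_
      filter_upwards [Ioi_mem_nhds hl] with x hx
      exact U1 x hx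
  have hUS : U z_S = utld (z_S / κ₁) + ε₁ * z_S := by
    rw [U2 z_S hzS_pos le_rfl]; linarith
  have hUc : ContinuousOn U (Set.Ioi 0) := by
    intro η hη
    by_cases hne : η = z_S
    · subst hne
      apply ContinuousAt.continuousWithinAt
      rw [continuousAt_iff_continuous_left_right]
      constructor
      · have h1 := (Ad κ₂ ε₂ η hκ₂p hη).continuousAt.continuousWithinAt (s := Set.Iic η)
        refine h1.congr_of_eventuallyEq ?_ (U2 η hη le_rfl)
        filter_upwards [self_mem_nhdsWithin, mem_nhdsWithin_of_mem_nhds (Ioi_mem_nhds hη)] with x a b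
        exact U2 x b a
      · have h1 := (Ad κ₁ ε₁ η hκ₁ hη).continuousAt.continuousWithinAt (s := Set.Ici η)
        refine h1.congr (fun x hx => ?_) hUS
        rcases eq_or_lt_of_le (show η ≤ x from hx) with e | e
        · rw [← e]; exact hUS
        · exact U1 x e
    · exact (hUd η hη hne).continuousAt.continuousWithinAt
  have hA : ∀ κ x y : ℝ, 0 < κ → 0 < x → x ≤ y → (1 / κ) * I (y / κ) ≤ (1 / κ) * I (x / κ) := by
    intro κ x y hκ hx hxy
    apply mul_le_mul_of_nonneg_left _ (by positivity)
    exact hI_anti.antitoneOn (show 0 < x / κ by positivity)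
      (show 0 < y / κ from div_pos (lt_of_lt_of_le hx hxy) hκ) (by gcongr)
  have hjump : ε₂ - (1 / κ₂) * I (z_S / κ₂) ≤ ε₁ - (1 / κ₁) * I (z_S / κ₁) := by
    have h1 := hT (z_S / κ₂) (z_S / κ₁) (by positivity) (by positivity)
    have h2 : I (z_S / κ₁) ≤ I (z_S / κ₂) := (hI_anti (show 0 < z_S / κ₂ by positivity)
      (show 0 < z_S / κ₁ by positivity) (hlt2 z_S hzS_pos)).le
    have h3 : z_S * ((1 / κ₁ - 1 / κ₂) * I (z_S / κ₁)) ≤ z_S * (ε₁ - ε₂) := by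
      have : (z_S / κ₁ - z_S / κ₂) * I (z_S / κ₁) =
        z_S * ((1 / κ₁ - 1 / κ₂) * I (z_S / κ₁)) := by ring
      linarith
    have h4 := le_of_mul_le_mul_left h3 hzS_pos
    have h5 := mul_le_mul_of_nonneg_left h2 (show 0 ≤ 1 / κ₂ by positivity)
    linarith
  have hvm : MonotoneOn v (Set.Ioi 0) := by
    intro x hx y hy hxy
    have hx0 : 0 < x := hx
    rcases le_or_gt y z_S with hyS | hyS
    · rw [v2 x hx (hxy.trans hyS), v2 y hy hyS]
      linarith [hA κ₂ x y hκ₂p hx hxy]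
    · rw [v1 y hyS]
      rcases le_or_gt x z_S with hxS | hxS
      · rw [v2 x hx hxS]
        linarith [hA κ₂ x z_S hκ₂p hx hxS, hA κ₁ z_S y hκ₁ hzS_pos hyS.le]
      · rw [v1 x hxS]
        linarith [hA κ₁ x y hκ₁ hx hxy]
  have hUb : ∀ η : ℝ, 0 < η → |U η| ≤ |utld η| + |u 0| + ε₁ * η := by
    intro η hη
    have key : ∀ κ ε : ℝ, 0 < κ → κ < 1 → 0 < ε → ε ≤ ε₁ →
        |utld (η / κ) + ε * η| ≤ |utld η| + |u 0| + ε₁ * η := by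
      intro κ ε h1 h2 h3 h4
      have a1 := habs η (η / κ) hη (hlt1 κ η h1 h2 hη).le
      have a2 := abs_add_le (utld (η / κ)) (ε * η)
      rw [abs_of_pos (mul_pos h3 hη)] at a2
      have a3 := mul_le_mul_of_nonneg_right h4 hη.le
      linarith
    rcases le_or_gt η z_S with hS | hS
    · rw [U2 η hη hS]; exact key κ₂ ε₂ hκ₂p hκ₂ hε₂ hε₁₂.le
    · rw [U1 η hS]; exact key κ₁ ε₁ hκ₁ (hκ₁₂.trans hκ₂) hε₁ le_rfl
  have hvb : ∀ η : ℝ, 0 < η → |v η| ≤ ε₁ + (1 / κ₁) * I η := by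
    intro η hη
    have key : ∀ κ ε : ℝ, κ₁ ≤ κ → κ < 1 → 0 < ε → ε ≤ ε₁ →
        |ε - (1 / κ) * I (η / κ)| ≤ ε₁ + (1 / κ₁) * I η := by
      intro κ ε h1 h2 h3 h4
      have hκ : 0 < κ := lt_of_lt_of_le hκ₁ h1
      have hp := hI_pos (η / κ) (by positivity)
      have a1 : I (η / κ) ≤ I η := (hI_anti (show 0 < η from hη)
        (show 0 < η / κ by positivity) (hlt1 κ η hκ h2 hη)).le
      have a2 : 1 / κ ≤ 1 / κ₁ := one_div_le_one_div_of_le hκ₁ h1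
      have a3 : (1 / κ) * I (η / κ) ≤ (1 / κ₁) * I η :=
        mul_le_mul a2 a1 hp.le (by positivity)
      have a4 : 0 < (1 / κ) * I (η / κ) := by positivity
      rw [abs_le]; constructor <;> linarith
    rcases le_or_gt η z_S with hS | hS
    · rw [v2 η hη hS]; exact key κ₂ ε₂ hκ₁₂.le hκ₂ hε₂ hε₁₂.le
    · rw [v1 η hS]; exact key κ₁ ε₁ le_rfl (hκ₁₂.trans hκ₂) hε₁ le_rfl
  obtain ⟨k2, kl2⟩ := aux_dom0 utld U n₂ (|u 0|) ε₁ hn₂0 hUc j2 jl2 hUb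
  have hUg : ∀ y η : ℝ, 0 < y → y ≤ η → |U η| ≤ (|utld y| + |u 0| + |u 0|) + ε₁ * η := by
    intro y η hy hη
    linarith [hUb η (lt_of_lt_of_le hy hη), habs y η hy hη]
  have k1 : ∀ y : ℝ, 0 < y → IntegrableOn (fun η => η ^ (-n₁ - 1) * U η) (Set.Ioi y) :=
    fun y hy => (aux_growth U n₁ ε₁ y _ hn₁1 hy hUc (fun η hη => hUg y η hy hη)).1
  have kl1 := (aux_growth U n₁ ε₁ 1 _ hn₁1 one_pos hUc (fun η hη => hUg 1 η one_pos hη)).2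
  have w1 : ∀ y : ℝ, 0 < y → IntegrableOn (fun η => η ^ (-n₁) * v η) (Set.Ioi y) :=
    fun y hy => aux_vinf v n₁ y (ε₁ + (1 / κ₁) * I y) hn₁1 hy hvm (fun η hη => by
      have a1 := hvb η (lt_of_lt_of_le hy hη)
      have a2 := hI_anti.antitoneOn hy (lt_of_lt_of_le hy hη) hη
      have a3 := mul_le_mul_of_nonneg_left a2 (show 0 ≤ 1 / κ₁ by positivity)
      linarith)
  have w2 : ∀ y : ℝ, 0 < y → IntegrableOn (fun η => η ^ (-n₂) * v η) (Set.Ioo 0 y) :=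
    fun y hy => aux_v0 v I n₂ ε₁ (1 / κ₁) y hn₂0 hy hvm (hI_int y hy) hvb
  have C1 : ∀ y : ℝ, 0 < y → ∫ η in Set.Ioi y, η ^ (-n₁) * v η = - (y ^ (-n₁) * U y) +
      n₁ * ∫ η in Set.Ioi y, η ^ (-n₁ - 1) * U η := fun y hy =>
    aux_bpinf U v z_S n₁ y hy hUc hUd hvm (w1 y hy) (k1 y hy) kl1
  have C2 : ∀ y : ℝ, 0 < y → ∫ η in Set.Ioo 0 y, η ^ (-n₂) * v η = y ^ (-n₂) * U y +
      n₂ * ∫ η in Set.Ioo 0 y, η ^ (-n₂ - 1) * U η := fun y hy =>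
    aux_bp0 U v z_S n₂ y hy hUc hUd hvm (w2 y hy) (k2 y hy) kl2
  have hzB : 0 < z_B := hzR_pos.trans hzRB
  -- h integrals
  have H1 : ∀ y : ℝ, 0 < y → ∫ η in Set.Ioi y, η ^ (-n₁ - 1) * h η =
      (∫ η in Set.Ioi y, η ^ (-n₁ - 1) * U η) - ∫ η in Set.Ioi y, η ^ (-n₁ - 1) * utld η := by
    intro y hy
    rw [← integral_sub (k1 y hy) (j1 y hy)]
    congr 1; ext η; simp only [hU]; ring
  have H2 : ∀ y : ℝ, 0 < y → ∫ η in Set.Ioo 0 y, η ^ (-n₂ - 1) * h η =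
      (∫ η in Set.Ioo 0 y, η ^ (-n₂ - 1) * U η) - ∫ η in Set.Ioo 0 y, η ^ (-n₂ - 1) * utld η := by
    intro y hy
    rw [← integral_sub (k2 y hy) (j2 y hy)]
    congr 1; ext η; simp only [hU]; ring
  set c₁ := ∫ η in Set.Ioi z_R, η ^ (-n₁ - 1) * h η with hc₁
  set c₂ := ∫ η in Set.Ioo 0 z_R, η ^ (-n₂ - 1) * h η with hc₂
  have P1 : ∫ η in Set.Ioi z_B, η ^ (-n₁) * v η = n₁ * c₁ := by
    have := hφ₁ z_R z_B hzR_pos hzB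
    rw [hφ₁RB] at this
    linarith
  have P2 : ∫ η in Set.Ioo 0 z_B, η ^ (-n₂) * v η = n₂ * c₂ := by
    have := hφ₂ z_R z_B hzR_pos hzB
    rw [hφ₂RB] at this
    linarith
  -- formulas for the brackets
  have X1 : ∀ z : ℝ, 0 < z → z ≤ z_B →
      n₁ * ((∫ η in Set.Ioi z, η ^ (-n₁ - 1) * U η) - c₁) =
      z ^ (-n₁) * U z + ∫ η in z..z_B, η ^ (-n₁) * v η := by
    intro z hz hzb
    have a1 := intervalIntegral.integral_Ioi_sub_Ioi (w1 z hz) hzb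
    have a2 := C1 z hz
    linarith
  have X2 : ∀ z : ℝ, 0 < z → z ≤ z_B →
      n₂ * ((∫ η in Set.Ioo 0 z, η ^ (-n₂ - 1) * U η) - c₂) =
      - (z ^ (-n₂) * U z) - ∫ η in z..z_B, η ^ (-n₂) * v η := by
    intro z hz hzb
    have a1 := aux_split0 _ z z_B hz hzb (w2 z_B hzB)
    have a2 := C2 z hz
    linarith
  have rr : ∀ x m : ℝ, 0 < x → x ^ m * x ^ (-m) = 1 := fun x m hx => by
    rw [← Real.rpow_add hx]; simp
  -- sign of h at z_R
  have hhR : h z_R < 0 := by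
    by_contra hcon
    push Not at hcon
    have hhc : ContinuousOn h (Set.Ioi 0) := by
      refine (hUc.sub huc).congr fun x _ => ?_
      simp [hU]
    have hκ₂' : 0 < 1 / κ₂ - 1 := by
      rw [sub_pos, lt_div_iff₀ hκ₂p]; linarith
    have ht : Filter.Tendsto (fun z => I (z / κ₂)) (nhdsWithin 0 (Set.Ioi 0)) Filter.atTop := by
      refine hI_zero.comp ?_
      refine tendsto_nhdsWithin_of_tendsto_nhds_of_eventually_within _ ?_ ?_
      · have : Filter.Tendsto (fun z : ℝ => z / κ₂) (nhds 0) (nhds (0 / κ₂)) :=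
          Filter.tendsto_id.div_const κ₂
        rw [zero_div] at this
        exact this.mono_left nhdsWithin_le_nhds
      · filter_upwards [self_mem_nhdsWithin] with x hx
        exact div_pos hx hκ₂p
    obtain ⟨z, hz1, hz2⟩ := ((ht.eventually_gt_atTop (ε₂ / (1 / κ₂ - 1))).and
      (Ioo_mem_nhdsGT (lt_min hzR_pos hzS_pos))).exists
    have hz0 : 0 < z := hz2.1
    have hzR' : z < z_R := lt_of_lt_of_le hz2.2 (min_le_left _ _)
    have hzS' : z ≤ z_S := (lt_of_lt_of_le hz2.2 (min_le_right _ _)).le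
    have hneg : h z ≤ 0 := by
      rw [hh₂ z hz0 hzS']
      have a1 := hT z (z / κ₂) hz0 (by positivity)
      rw [div_lt_iff₀ hκ₂'] at hz1
      have a2 := mul_le_mul_of_nonneg_left hz1.le hz0.le
      have a3 : (z / κ₂ - z) * I (z / κ₂) = z * (I (z / κ₂) * (1 / κ₂ - 1)) := by ring
      linarith
    obtain ⟨w, hw, hw'⟩ := intermediate_value_Icc hzR'.le
      (hhc.mono (fun x hx => lt_of_lt_of_le hz0 hx.1)) ⟨hneg, hcon⟩
    have := hzhat_uniq w (lt_of_lt_of_le hz0 hw.1) hw'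
    linarith [hw.2]
  -- D at z_R
  have hDR : 0 < (n₁ - 1) * (z_R ^ n₁ * ∫ η in z_R..z_B, η ^ (-n₁) * v η) +
      (1 - n₂) * (z_R ^ n₂ * ∫ η in z_R..z_B, η ^ (-n₂) * v η) := by
    have a1 := X1 z_R hzR_pos hzRB.le
    have a2 := X2 z_R hzR_pos hzRB.le
    rw [hc₁, H1 z_R hzR_pos, sub_sub_cancel, B1 z_R hzR_pos] at a1
    rw [hc₂, H2 z_R hzR_pos, sub_sub_cancel, B2 z_R hzR_pos] at a2
    have a3 := aux_I0 I n₂ z_R hn₂0 hzR_pos hI_anti (hI_int z_R hzR_pos)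
    have a4 := aux_Iinf I n₁ z_R hn₁1 hzR_pos hI_anti (hI1 z_R hzR_pos)
    have r1 := rr z_R n₁ hzR_pos
    have r2 := rr z_R n₂ hzR_pos
    have hUR : U z_R = h z_R + utld z_R := rfl
    have e1 : z_R ^ n₁ * ∫ η in z_R..z_B, η ^ (-n₁) * v η =
        - h z_R - z_R ^ n₁ * ∫ η in Set.Ioi z_R, η ^ (-n₁) * I η := by
      linear_combination (- z_R ^ n₁) * a1 - (U z_R - utld z_R) * r1 - hUR
    have e2 : z_R ^ n₂ * ∫ η in z_R..z_B, η ^ (-n₂) * v η =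
        - h z_R + z_R ^ n₂ * ∫ η in Set.Ioo 0 z_R, η ^ (-n₂) * I η := by
      linear_combination (z_R ^ n₂) * a2 - (U z_R - utld z_R) * r2 - hUR
    rw [e1, e2]
    have key : ∀ A B H w : ℝ, w < (1 - n₂) * B → (n₁ - 1) * A ≤ w → 0 < (n₁ - n₂) * (-H) →
        0 < (n₁ - 1) * (- H - A) + (1 - n₂) * (- H + B) := by
      intro A B H w k1 k2 k3
      linarith
    exact key _ _ _ _ a3 a4 (mul_pos (by linarith) (neg_pos.2 hhR))
  have hDz : ∀ z, z_R < z → z < z_B → 0 < (n₁ - 1) * (z ^ n₁ * ∫ η in z..z_B, η ^ (-n₁) * v η) +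
      (1 - n₂) * (z ^ n₂ * ∫ η in z..z_B, η ^ (-n₂) * v η) := fun z h1 h2 =>
    aux_D v n₁ n₂ z_R z z_B hzR_pos h1 h2 hn₁1 hn₂0 hvm hDR
  -- derivatives
  have SJ := aux_S_s19 utld n₁ n₂ 0 0 huc j1 j2
  have SU := aux_S_s19 U n₁ n₂ c₁ c₂ hUc k1 k2
  set RJ : ℝ → ℝ := fun z => (z ^ n₂ * (n₂ * ((∫ η in Set.Ioo 0 z, η ^ (-n₂ - 1) * utld η) - 0)) +
      z ^ n₁ * (n₁ * ((∫ η in Set.Ioi z, η ^ (-n₁ - 1) * utld η) - 0))) / z with hRJ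
  set RU : ℝ → ℝ := fun z => (z ^ n₂ * (n₂ * ((∫ η in Set.Ioo 0 z, η ^ (-n₂ - 1) * U η) - c₂)) +
      z ^ n₁ * (n₁ * ((∫ η in Set.Ioi z, η ^ (-n₁ - 1) * U η) - c₁))) / z with hRU
  set γ := 2 / (θ ^ 2 * (n₁ - n₂)) with hγ
  have hγp : 0 < γ := by
    have : 0 < n₁ - n₂ := by linarith
    positivity
  have QJ : ∀ z, 0 < z → z ≤ z_R → Q z = γ * (z ^ n₂ *
      ((∫ η in Set.Ioo 0 z, η ^ (-n₂ - 1) * utld η) - 0) +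
      z ^ n₁ * ((∫ η in Set.Ioi z, η ^ (-n₁ - 1) * utld η) - 0)) := fun z h1 h2 => by
    rw [hQ₁ z h1 h2, hJR z h1, sub_zero, sub_zero]
  have QU : ∀ z, z_R ≤ z → z ≤ z_B → Q z = γ * (z ^ n₂ *
      ((∫ η in Set.Ioo 0 z, η ^ (-n₂ - 1) * U η) - c₂) +
      z ^ n₁ * ((∫ η in Set.Ioi z, η ^ (-n₁ - 1) * U η) - c₁)) := fun z h1 h2 => by
    have hz : 0 < z := lt_of_lt_of_le hzR_pos h1
    rw [hQ₂ z h1 h2, hJR z hz, hΨ z hz, H1 z hz, H2 z hz, hE₁, hE₂]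
    ring
  have hRR : RJ z_R = RU z_R := by
    simp only [hRJ, hRU]
    rw [hc₁, hc₂, H1 z_R hzR_pos, H2 z_R hzR_pos]
    ring
  have DJ : ∀ z, 0 < z → z < z_R → HasDerivAt Q (γ * RJ z) z := fun z h1 h2 => by
    refine ((SJ z h1).1.const_mul γ).congr_of_eventuallyEq ?_
    filter_upwards [Ioo_mem_nhds h1 h2] with x hx
    exact QJ x hx.1 hx.2.le
  have DU : ∀ z, z_R < z → z < z_B → HasDerivAt Q (γ * RU z) z := fun z h1 h2 => by
    refine ((SU z (hzR_pos.trans h1)).1.const_mul γ).congr_of_eventuallyEq ?_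
    filter_upwards [Ioo_mem_nhds h1 h2] with x hx
    exact QU x hx.1.le hx.2.le
  have DR : HasDerivAt Q (γ * RU z_R) z_R := by
    have l : HasDerivWithinAt Q (γ * RU z_R) (Set.Iic z_R) z_R := by
      rw [← hRR]
      refine ((SJ z_R hzR_pos).1.const_mul γ).hasDerivWithinAt.congr_of_eventuallyEq ?_
        (QJ z_R hzR_pos le_rfl)
      filter_upwards [self_mem_nhdsWithin, mem_nhdsWithin_of_mem_nhds (Ioi_mem_nhds hzR_pos)]
        with x a b
      exact QJ x b a
    have r : HasDerivWithinAt Q (γ * RU z_R) (Set.Ici z_R) z_R := by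
      refine ((SU z_R hzR_pos).1.const_mul γ).hasDerivWithinAt.congr_of_eventuallyEq ?_
        (QU z_R le_rfl hzRB.le)
      filter_upwards [self_mem_nhdsWithin, mem_nhdsWithin_of_mem_nhds (Iio_mem_nhds hzRB)]
        with x a b
      exact QU x a (le_of_lt b)
    have := l.union r
    rw [Set.Iic_union_Ici] at this
    exact this.hasDerivAt Filter.univ_mem
  have MJ : StrictMonoOn RJ (Set.Ioc 0 z_R) := by
    apply strictMonoOn_of_deriv_pos (convex_Ioc 0 z_R)
    · intro x hx
      exact (SJ x hx.1).2.continuousAt.continuousWithinAt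
    · intro x hx
      rw [interior_Ioc] at hx
      have hx0 := hx.1
      rw [(SJ x hx0).2.deriv, sub_zero, sub_zero, B1 x hx0, B2 x hx0]
      have a3 := aux_I0 I n₂ x hn₂0 hx0 hI_anti (hI_int x hx0)
      have a4 := aux_Iinf I n₁ x hn₁1 hx0 hI_anti (hI1 x hx0)
      have r1 := rr x n₁ hx0
      have r2 := rr x n₂ hx0
      apply div_pos _ (by positivity)
      have : (n₂ - 1) * (x ^ n₂ * (-(x ^ (-n₂) * utld x) - ∫ η in Set.Ioo 0 x, η ^ (-n₂) * I η)) +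
          (n₁ - 1) * (x ^ n₁ * (x ^ (-n₁) * utld x - ∫ η in Set.Ioi x, η ^ (-n₁) * I η)) +
          (n₂ - n₁) * utld x =
          (1 - n₂) * (x ^ n₂ * ∫ η in Set.Ioo 0 x, η ^ (-n₂) * I η) -
          (n₁ - 1) * (x ^ n₁ * ∫ η in Set.Ioi x, η ^ (-n₁) * I η) := by
        linear_combination (1 - n₂) * utld x * r2 + (n₁ - 1) * utld x * r1
      rw [this]; linarith
  have MU : StrictMonoOn RU (Set.Ico z_R z_B) := by
    apply strictMonoOn_of_deriv_pos (convex_Ico z_R z_B)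
    · intro x hx
      exact (SU x (lt_of_lt_of_le hzR_pos hx.1)).2.continuousAt.continuousWithinAt
    · intro x hx
      rw [interior_Ico] at hx
      have hx0 := hzR_pos.trans hx.1
      rw [(SU x hx0).2.deriv, X1 x hx0 hx.2.le, X2 x hx0 hx.2.le]
      have a3 := hDz x hx.1 hx.2
      have r1 := rr x n₁ hx0
      have r2 := rr x n₂ hx0
      apply div_pos _ (by positivity)
      refine lt_of_lt_of_eq a3 ?_
      linear_combination -(1 - n₂) * U x * r2 - (n₁ - 1) * U x * r1
  -- the derivative function
  set d : ℝ → ℝ := fun z => if z < z_R then γ * RJ z else γ * RU z with hd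
  have dJ : ∀ z, z ≤ z_R → d z = γ * RJ z := fun z hz => by
    rcases eq_or_lt_of_le hz with e | e
    · simp only [hd, e, lt_irrefl, if_false, hRR]
    · simp only [hd, e, if_true]
  have dU : ∀ z, z_R ≤ z → d z = γ * RU z := fun z hz => by
    simp only [hd, not_lt.2 hz, if_false]
  refine aux_ivt Q d z_B hzB ?_ ?_ ?_ ?_
  · have m1 : StrictMonoOn d (Set.Ioc 0 z_R) := fun x hx y hy hxy => by
      rw [dJ x hx.2, dJ y hy.2]
      exact mul_lt_mul_of_pos_left (MJ hx hy hxy) hγp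
    have m2 : StrictMonoOn d (Set.Ico z_R z_B) := fun x hx y hy hxy => by
      rw [dU x hx.1, dU y hy.1]
      exact mul_lt_mul_of_pos_left (MU hx hy hxy) hγp
    have m3 := m1.union m2 (c := z_R) ⟨⟨hzR_pos, le_rfl⟩, fun x hx => hx.2⟩
      ⟨⟨le_rfl, hzRB⟩, fun x hx => hx.1⟩
    refine m3.mono fun x hx => ?_
    rcases le_total x z_R with e | e
    · exact Or.inl ⟨hx.1, e⟩
    · exact Or.inr ⟨e, hx.2⟩
  · intro y hy
    rcases lt_trichotomy y z_R with e | e | e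
    · rw [dJ y e.le]; exact DJ y hy.1 e
    · rw [dU y e.ge, e]; exact DR
    · rw [dU y e.le]; exact DU y e hy.2
  · have hn : 0 < 1 - n₂ := by linarith
    have t1 : Filter.Tendsto (fun y => -(γ / (1 - n₂) * I y)) (nhdsWithin 0 (Set.Ioi 0))
        Filter.atBot :=
      Filter.tendsto_neg_atTop_atBot.comp (hI_zero.const_mul_atTop (div_pos hγp hn))
    refine Filter.tendsto_atBot_mono' _ ?_ t1
    filter_upwards [Ioo_mem_nhdsGT hzR_pos] with y hy
    have hy0 := hy.1
    rw [dJ y hy.2.le]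
    have a3 := aux_I0 I n₂ y hn₂0 hy0 hI_anti (hI_int y hy0)
    have a5 : 0 ≤ ∫ η in Set.Ioi y, η ^ (-n₁) * I η :=
      setIntegral_nonneg measurableSet_Ioi fun x hx =>
        mul_nonneg (Real.rpow_nonneg (hy0.trans hx).le _) (hI_pos x (hy0.trans hx)).le
    have a6 := mul_nonneg (Real.rpow_nonneg hy0.le n₁) a5
    have r1 := rr y n₁ hy0
    have r2 := rr y n₂ hy0
    have e : RJ y = -((y ^ n₂ * ∫ η in Set.Ioo 0 y, η ^ (-n₂) * I η) +
        (y ^ n₁ * ∫ η in Set.Ioi y, η ^ (-n₁) * I η)) / y := by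
      simp only [hRJ]
      rw [sub_zero, sub_zero, B1 y hy0, B2 y hy0]
      congr 1
      linear_combination utld y * r1 - utld y * r2
    have : RJ y ≤ -(I y / (1 - n₂)) := by
      rw [e, div_le_iff₀ hy0, neg_mul, neg_le_neg_iff, div_mul_eq_mul_div, div_le_iff₀ hn]
      have := mul_nonneg hn.le a6
      linarith
    have := mul_le_mul_of_nonneg_left this hγp.le
    refine this.trans (le_of_eq ?_)
    ring
  · have c0 : RU z_B = 0 := by
      simp only [hRU]
      rw [X1 z_B hzB le_rfl, X2 z_B hzB le_rfl]
      simp only [intervalIntegral.integral_same]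
      have r1 := rr z_B n₁ hzB
      have r2 := rr z_B n₂ hzB
      rw [div_eq_zero_iff]; left
      linear_combination U z_B * r1 - U z_B * r2
    have t1 := ((SU z_B hzB).2.continuousAt.tendsto.const_mul γ).mono_left
      (nhdsWithin_le_nhds (s := Set.Iio z_B))
    rw [show γ * _ = 0 from by rw [show _ = (0:ℝ) from c0, mul_zero]] at t1
    refine t1.congr' ?_
    filter_upwards [Ioo_mem_nhdsLT hzRB] with y hy
    exact (dU y hy.1.le).symm
end
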